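/- arXiv:1112.1716 — 2 statements merged into one kernel-verified Lean document; each statement's English description precedes it below -/
import Mathlib

section
/- Let d ≥ 2. There exists a constant γ_d > 0, depending only on d, with the following property: for every x₀ ∈ ℝ^d, r₀ > 0, Ω = B(x₀, 3r₀), every measurable bounded W : Ω → ℝ, every finite-dimensional linear subspace J of E₀(Ω), and every N ∈ ℕ, one has dim (J ∩ E_{N+1}(Ω)) ≥ dim J − γ_d N^{d−1}. -/
open MeasureTheory

/-- The Laplacian `Δf = ∑ j ∂²f/∂x_j²` of a function on `ℝ^d`. -/
noncomputable def lap {d : ℕ} (f : EuclideanSpace ℝ (Fin d) → ℝ)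
    (x : EuclideanSpace ℝ (Fin d)) : ℝ :=
  ∑ i, fderiv ℝ (fun y => fderiv ℝ f y (EuclideanSpace.single i 1)) x
    (EuclideanSpace.single i 1)

/-- `E₀(Ω)`: real-valued, twice continuously differentiable, square-integrable solutions
of `Δφ = Wφ` a.e. on `Ω`. -/
def solSet {d : ℕ} (Ω : Set (EuclideanSpace ℝ (Fin d)))
    (W : EuclideanSpace ℝ (Fin d) → ℝ) : Set (EuclideanSpace ℝ (Fin d) → ℝ) :=
  {φ | ContDiffOn ℝ 2 φ Ω ∧ IntegrableOn (fun x => φ x ^ 2) Ω ∧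
    ∀ᵐ x ∂volume, x ∈ Ω → lap φ x = W x * φ x}

/-- `E_N(Ω)`: solutions with `limsup_{x→x₀} |φ(x)|/|x-x₀|^N < ∞`, i.e. with
`|φ(x)| ≤ M |x-x₀|^N` near (but off) `x₀` for some `M`. -/
def solSetN {d : ℕ} (Ω : Set (EuclideanSpace ℝ (Fin d)))
    (W : EuclideanSpace ℝ (Fin d) → ℝ) (x₀ : EuclideanSpace ℝ (Fin d)) (N : ℕ) :
    Set (EuclideanSpace ℝ (Fin d) → ℝ) :=
  {φ ∈ solSet Ω W |
    ∃ M : ℝ, ∀ᶠ x in nhdsWithin x₀ {x₀}ᶜ, |φ x| ≤ M * ‖x - x₀‖ ^ N}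

namespace VanishingOrder

open Set Filter Topology Asymptotics
open scoped ContDiff

variable {d : ℕ}

/-- The partial derivative `∂ᵢ f`. -/
noncomputable def partialDeriv (i : Fin d) (f : EuclideanSpace ℝ (Fin d) → ℝ) :
    EuclideanSpace ℝ (Fin d) → ℝ :=
  fun y => fderiv ℝ f y (EuclideanSpace.single i 1)

/-- The iterated partial derivative along the letters of a word. -/
noncomputable def wordDeriv (w : List (Fin d)) (f : EuclideanSpace ℝ (Fin d) → ℝ) :
    EuclideanSpace ℝ (Fin d) → ℝ :=
  w.foldr partialDeriv f

/-- Smooth functions supported in the closed unit ball. -/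
structure IsTestFunction (η : EuclideanSpace ℝ (Fin d) → ℝ) : Prop where
  contDiff : ContDiff ℝ ∞ η
  tsupport_subset : tsupport η ⊆ Metric.closedBall 0 1

lemma lap_eq_sum (f : EuclideanSpace ℝ (Fin d) → ℝ) (x : EuclideanSpace ℝ (Fin d)) :
    lap f x = ∑ i, partialDeriv i (partialDeriv i f) x := rfl

lemma contDiff_partialDeriv {f : EuclideanSpace ℝ (Fin d) → ℝ} {m n : WithTop ℕ∞}
    (hf : ContDiff ℝ n f) (hmn : m + 1 ≤ n) (i : Fin d) : ContDiff ℝ m (partialDeriv i f) :=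
  (hf.fderiv_right hmn).clm_apply contDiff_const

lemma continuous_lap {f : EuclideanSpace ℝ (Fin d) → ℝ} (hf : ContDiff ℝ 2 f) :
    Continuous (lap f) :=
  continuous_finsetSum _ fun i _ =>
    (contDiff_partialDeriv (m := 0) (contDiff_partialDeriv (m := 1) hf (by norm_num) i)
      (by norm_num) i).continuous

lemma fderiv_apply_eq_sum (f : EuclideanSpace ℝ (Fin d) → ℝ) (x v : EuclideanSpace ℝ (Fin d)) :
    fderiv ℝ f x v = ∑ i, v i * partialDeriv i f x := by
  conv_lhs => rw [← (EuclideanSpace.basisFun (Fin d) ℝ).sum_repr v]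
  simp [partialDeriv]

namespace IsTestFunction

variable {η : EuclideanSpace ℝ (Fin d) → ℝ}

lemma hasCompactSupport (h : IsTestFunction η) : HasCompactSupport η :=
  (isCompact_closedBall _ _).of_isClosed_subset (isClosed_tsupport _) h.tsupport_subset

lemma contDiff_two (h : IsTestFunction η) : ContDiff ℝ 2 η := contDiff_infty.1 h.contDiff 2

lemma differentiable (h : IsTestFunction η) : Differentiable ℝ η :=
  h.contDiff.differentiable (by simp)

lemma eq_zero (h : IsTestFunction η) {z : EuclideanSpace ℝ (Fin d)} (hz : 1 < ‖z‖) : η z = 0 := by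
  by_contra hne
  have := h.tsupport_subset (subset_tsupport η hne)
  simp at this
  linarith

lemma partialDeriv (h : IsTestFunction η) (i : Fin d) : IsTestFunction (partialDeriv i η) where
  contDiff := contDiff_partialDeriv h.contDiff (by simp) i
  tsupport_subset := by
    refine subset_trans ?_ ((tsupport_fderiv_subset ℝ (f := η)).trans h.tsupport_subset)
    exact closure_mono fun x hx hx' => hx (by simp [VanishingOrder.partialDeriv, hx'])

lemma wordDeriv (h : IsTestFunction η) (w : List (Fin d)) : IsTestFunction (wordDeriv w η) := by
  induction w with
  | nil => exact h
  | cons i w ih => exact ih.partialDeriv i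

lemma coord_mul (h : IsTestFunction η) (i : Fin d) : IsTestFunction fun z => z i * η z where
  contDiff := by
    have := h.contDiff
    have h2 : ContDiff ℝ ∞ fun z : EuclideanSpace ℝ (Fin d) => z i := by fun_prop
    exact h2.mul this
  tsupport_subset := (closure_mono fun z hz => by
    simp only [Function.mem_support] at hz ⊢
    exact right_ne_zero_of_mul hz).trans h.tsupport_subset

end IsTestFunction

lemma partialDeriv_comm {f : EuclideanSpace ℝ (Fin d) → ℝ} (hf : ContDiff ℝ 2 f) (i j : Fin d) :
    partialDeriv i (partialDeriv j f) = partialDeriv j (partialDeriv i f) := by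
  have key : ∀ (i j : Fin d) x, partialDeriv i (partialDeriv j f) x =
      fderiv ℝ (fderiv ℝ f) x (EuclideanSpace.single i 1) (EuclideanSpace.single j 1) := by
    intro i j x
    have hd : DifferentiableAt ℝ (fderiv ℝ f) x :=
      ((hf.fderiv_right (m := 1) (by norm_num)).differentiable (by norm_num)) x
    unfold partialDeriv
    rw [fderiv_clm_apply hd (by fun_prop)]
    simp
  ext x
  rw [key, key]
  exact (hf.contDiffAt.isSymmSndFDerivAt (by simp)) _ _

lemma wordDeriv_perm {f : EuclideanSpace ℝ (Fin d) → ℝ} (hf : ContDiff ℝ ∞ f)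
    {v w : List (Fin d)} (h : v.Perm w) : wordDeriv v f = wordDeriv w f := by
  have smooth : ∀ w, ContDiff ℝ ∞ (wordDeriv w f) := by
    intro w
    induction w with
    | nil => exact hf
    | cons i w ih => exact contDiff_partialDeriv ih (by simp) i
  induction h with
  | nil => rfl
  | cons i _ ih => exact congrArg (partialDeriv i) ih
  | swap i j l => exact partialDeriv_comm (contDiff_infty.1 (smooth l) 2) j i
  | trans _ _ ih₁ ih₂ => exact ih₁.trans ih₂

lemma partialDeriv_add {f g : EuclideanSpace ℝ (Fin d) → ℝ} (hf : Differentiable ℝ f)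
    (hg : Differentiable ℝ g) (i : Fin d) :
    partialDeriv i (fun x => f x + g x) = fun x => partialDeriv i f x + partialDeriv i g x := by
  ext x
  simp [partialDeriv, fderiv_fun_add (hf x) (hg x)]

lemma partialDeriv_sum {ι : Type*} {s : Finset ι} {f : ι → EuclideanSpace ℝ (Fin d) → ℝ}
    (hf : ∀ j, Differentiable ℝ (f j)) (i : Fin d) :
    partialDeriv i (fun x => ∑ j ∈ s, f j x) = fun x => ∑ j ∈ s, partialDeriv i (f j) x := by
  ext x
  simp [partialDeriv, fderiv_fun_sum fun j _ => hf j x]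

lemma partialDeriv_const_mul {f : EuclideanSpace ℝ (Fin d) → ℝ} (hf : Differentiable ℝ f)
    (c : ℝ) (i : Fin d) :
    partialDeriv i (fun x => c * f x) = fun x => c * partialDeriv i f x := by
  ext x
  simp [partialDeriv, fderiv_const_mul (hf x) c]

lemma partialDeriv_coord_mul {f : EuclideanSpace ℝ (Fin d) → ℝ} (hf : Differentiable ℝ f)
    (i j : Fin d) :
    partialDeriv i (fun x => x j * f x) =
      fun x => x j * partialDeriv i f x + (if j = i then f x else 0) := by
  ext x
  have h1 : HasFDerivAt (fun x : EuclideanSpace ℝ (Fin d) => x j)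
      (EuclideanSpace.proj j : EuclideanSpace ℝ (Fin d) →L[ℝ] ℝ) x :=
    (EuclideanSpace.proj j : EuclideanSpace ℝ (Fin d) →L[ℝ] ℝ).hasFDerivAt
  have h2 := (h1.mul (hf x).hasFDerivAt).fderiv
  unfold partialDeriv
  rw [show (fun x : EuclideanSpace ℝ (Fin d) => x j * f x) =
    (fun x : EuclideanSpace ℝ (Fin d) => x j) * f from rfl, h2]
  simp

/-- If `∂ᵢψ = -zᵢρ`, then every iterated derivative satisfies
`∑ ∂ᵢ(zᵢ ∂ʷρ) = -|w| ∂ʷρ - Δ∂ʷψ`. -/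
lemma sum_partialDeriv_coord_mul_wordDeriv {ψ ρ : EuclideanSpace ℝ (Fin d) → ℝ}
    (hψ : IsTestFunction ψ) (hρ : IsTestFunction ρ)
    (h : ∀ i z, partialDeriv i ψ z = -(z i * ρ z)) (w : List (Fin d))
    (z : EuclideanSpace ℝ (Fin d)) :
    ∑ i, partialDeriv i (fun z => z i * wordDeriv w ρ z) z =
      -(w.length * wordDeriv w ρ z) - lap (wordDeriv w ψ) z := by
  induction w generalizing z with
  | nil =>
    have h' : ∀ i, partialDeriv i ψ = fun z => (-1) * (z i * ρ z) := fun i => by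
      ext z; rw [h]; ring
    have h'' := fun i => partialDeriv_const_mul (hρ.coord_mul i).differentiable (-1) i
    simp only [lap_eq_sum, wordDeriv, List.foldr_nil, List.length_nil, h', h'']
    simp
  | cons j w ih =>
    have ih' := congrArg (fun F => partialDeriv j F z) (funext ih)
    have e1 : ∀ i, partialDeriv i (fun z => z i * wordDeriv (j :: w) ρ z) z =
        partialDeriv j (partialDeriv i (fun z => z i * wordDeriv w ρ z)) z -
          (if i = j then partialDeriv i (wordDeriv w ρ) z else 0) := by
      intro i
      rw [partialDeriv_comm ((hρ.wordDeriv w).coord_mul i).contDiff_two,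
        partialDeriv_coord_mul ((hρ.wordDeriv w).differentiable)]
      rcases eq_or_ne i j with rfl | hij
      · simp only [if_true]
        rw [partialDeriv_add ((((hρ.wordDeriv w).partialDeriv i).coord_mul i).differentiable)
          ((hρ.wordDeriv w).differentiable)]
        simp [wordDeriv]
      · simp [hij, wordDeriv]
    have e2 : ∀ i, partialDeriv i (partialDeriv i (wordDeriv (j :: w) ψ)) =
        partialDeriv j (partialDeriv i (partialDeriv i (wordDeriv w ψ))) := by
      intro i
      change partialDeriv i (partialDeriv i (partialDeriv j (wordDeriv w ψ))) = _
      rw [partialDeriv_comm (hψ.wordDeriv w).contDiff_two i j,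
        partialDeriv_comm ((hψ.wordDeriv w).partialDeriv i).contDiff_two i j]
    have hsum : partialDeriv j (fun z => -(w.length * wordDeriv w ρ z) - lap (wordDeriv w ψ) z) z =
        -(w.length * wordDeriv (j :: w) ρ z) - lap (wordDeriv (j :: w) ψ) z := by
      have e : (fun z => -((w.length : ℝ) * wordDeriv w ρ z) - lap (wordDeriv w ψ) z) =
          fun z => (-(w.length : ℝ)) * wordDeriv w ρ z + (-1) *
            ∑ i, partialDeriv i (partialDeriv i (wordDeriv w ψ)) z := by
        ext z; rw [lap_eq_sum]; ring
      have hd1 := fun i => (((hψ.wordDeriv w).partialDeriv i).partialDeriv i).differentiable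
      have hd2 : Differentiable ℝ fun z =>
          ∑ i, partialDeriv i (partialDeriv i (wordDeriv w ψ)) z :=
        Differentiable.fun_sum fun i _ => hd1 i
      rw [e, partialDeriv_add (((hρ.wordDeriv w).differentiable).const_mul _) (hd2.const_mul _),
        partialDeriv_const_mul ((hρ.wordDeriv w).differentiable), partialDeriv_const_mul hd2,
        partialDeriv_sum hd1]
      simp only [lap_eq_sum, e2]
      simp only [wordDeriv, List.foldr_cons]
      ring
    rw [partialDeriv_sum fun i =>
      (((hρ.wordDeriv w).coord_mul i).partialDeriv i).differentiable] at ih'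
    rw [Finset.sum_congr rfl fun i _ => e1 i, Finset.sum_sub_distrib]
    have ih'' := ih'.trans hsum
    simp only at ih''
    rw [ih'']
    simp [wordDeriv]
    ring

lemma exists_test_pair (d : ℕ) [NeZero d] : ∃ ψ ρ : EuclideanSpace ℝ (Fin d) → ℝ,
    IsTestFunction ψ ∧ IsTestFunction ρ ∧ (∀ i z, partialDeriv i ψ z = -(z i * ρ z)) ∧
      0 < ∫ z, ρ z := by
  set g := Real.smoothTransition
  have hg : ContDiff ℝ ∞ g := Real.smoothTransition.contDiff
  have hg' : ContDiff ℝ ∞ (deriv g) := (contDiff_infty_iff_deriv.1 hg).2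
  have hn : ContDiff ℝ ∞ fun z : EuclideanSpace ℝ (Fin d) => 1 - ‖z‖ ^ 2 :=
    contDiff_const.sub (contDiff_norm_sq ℝ)
  have hneg : ∀ s < 0, g s = 0 ∧ deriv g s = 0 := fun s hs => by
    refine ⟨Real.smoothTransition.zero_of_nonpos hs.le, ?_⟩
    have : g =ᶠ[𝓝 s] fun _ => 0 := by
      filter_upwards [Iio_mem_nhds hs] with t ht
      exact Real.smoothTransition.zero_of_nonpos (le_of_lt ht)
    rw [this.deriv_eq]; simp
  have hsupp : ∀ F : EuclideanSpace ℝ (Fin d) → ℝ, (∀ z, 1 < ‖z‖ → F z = 0) →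
      tsupport F ⊆ Metric.closedBall 0 1 := by
    intro F hF
    refine closure_minimal (fun z hz => ?_) Metric.isClosed_closedBall
    by_contra hz'
    exact hz (hF z (by simpa using hz'))
  have hlt : ∀ z : EuclideanSpace ℝ (Fin d), 1 < ‖z‖ → 1 - ‖z‖ ^ 2 < 0 := fun z hz => by
    nlinarith
  have hρ : IsTestFunction fun z : EuclideanSpace ℝ (Fin d) => 2 * deriv g (1 - ‖z‖ ^ 2) :=
    ⟨contDiff_const.mul (hg'.comp hn), hsupp _ fun z hz => by simp [(hneg _ (hlt z hz)).2]⟩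
  refine ⟨fun z => g (1 - ‖z‖ ^ 2), fun z => 2 * deriv g (1 - ‖z‖ ^ 2),
    ⟨hg.comp hn, hsupp _ fun z hz => (hneg _ (hlt z hz)).1⟩, hρ, ?_, ?_⟩
  · intro i z
    have h1 : HasDerivAt g (deriv g (1 - ‖z‖ ^ 2)) (1 - ‖z‖ ^ 2) :=
      (hg.differentiable (by simp) _).hasDerivAt
    have h2 : HasFDerivAt (fun z : EuclideanSpace ℝ (Fin d) => 1 - ‖z‖ ^ 2)
        (-(2 • innerSL ℝ z)) z := (hasStrictFDerivAt_norm_sq z).hasFDerivAt.const_sub 1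
    have h3 := (h1.comp_hasFDerivAt z h2).fderiv
    change fderiv ℝ (g ∘ fun z => 1 - ‖z‖ ^ 2) z _ = _
    rw [h3]
    simp [EuclideanSpace.inner_single_right]
    ring
  · obtain ⟨s, hs, hs'⟩ := exists_deriv_eq_slope g zero_lt_one hg.continuous.continuousOn
      (hg.differentiable (by simp)).differentiableOn
    have hs1 : deriv g s = 1 := by
      rw [hs']; simp [g, Real.smoothTransition.one, Real.smoothTransition.zero]
    refine hρ.contDiff.continuous.integral_pos_of_hasCompactSupport_nonneg_nonzero
      (x := EuclideanSpace.single 0 √(1 - s)) hρ.hasCompactSupport (fun z => ?_) ?_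
    · have := Real.smoothTransition.monotone.deriv_nonneg (x := 1 - ‖z‖ ^ 2)
      simpa using this
    · have : ‖√(1 - s)‖ ^ 2 = 1 - s := by
        rw [Real.norm_eq_abs, sq_abs, Real.sq_sqrt (by linarith [hs.2])]
      simp only [PiLp.norm_single, this]
      simp [hs1]

section Averages

variable {u η : EuclideanSpace ℝ (Fin d) → ℝ}

lemma IsTestFunction.integrable_mul (hη : IsTestFunction η) (hu : Continuous u) :
    Integrable fun z => u z * η z :=
  (hu.mul hη.contDiff.continuous).integrable_of_hasCompactSupport hη.hasCompactSupport.mul_left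

lemma abs_integral_mul_le (hη : IsTestFunction η) {B : ℝ}
    (hB : ∀ z, ‖z‖ ≤ 1 → |u z| ≤ B) : |∫ z, u z * η z| ≤ B * ∫ z, |η z| := by
  rw [← integral_const_mul, ← Real.norm_eq_abs]
  refine norm_integral_le_of_norm_le ((hη.contDiff.continuous.integrable_of_hasCompactSupport
    hη.hasCompactSupport).abs.const_mul B) (Eventually.of_forall fun z => ?_)
  rw [Real.norm_eq_abs, abs_mul]
  rcases le_or_gt ‖z‖ 1 with hz | hz
  · exact mul_le_mul_of_nonneg_right (hB z hz) (abs_nonneg _)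
  · simp [hη.eq_zero hz]

lemma hasDerivAt_integral_comp_mul (hu : ContDiff ℝ 1 u) (hη : IsTestFunction η)
    {p q : EuclideanSpace ℝ (Fin d) → EuclideanSpace ℝ (Fin d)} (hp : Continuous p)
    (hq : Continuous q) (t : ℝ) :
    HasDerivAt (fun t : ℝ => ∫ z, u (p z + t • q z) * η z)
      (∫ z, fderiv ℝ u (p z + t • q z) (q z) * η z) t := by
  have hu' : Continuous (fderiv ℝ u) := hu.continuous_fderiv (by norm_num)
  have hηc := hη.contDiff.continuous
  have hF : Continuous fun a : ℝ × EuclideanSpace ℝ (Fin d) =>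
      fderiv ℝ u (p a.2 + a.1 • q a.2) (q a.2) * η a.2 := by fun_prop
  obtain ⟨B, hB⟩ := ((isCompact_closedBall t 1).prod
    (isCompact_closedBall (0 : EuclideanSpace ℝ (Fin d)) 1)).exists_bound_of_continuousOn
    hF.continuousOn
  refine (hasDerivAt_integral_of_dominated_loc_of_deriv_le (Metric.ball_mem_nhds t one_pos)
    (F' := fun t z => fderiv ℝ u (p z + t • q z) (q z) * η z)
    (bound := (Metric.closedBall (0 : EuclideanSpace ℝ (Fin d)) 1).indicator fun _ => B)
    (Eventually.of_forall fun s => ?_) ?_ ?_ ?_ ?_ ?_).2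
  · exact (Continuous.mul (hu.continuous.comp (by fun_prop)) hηc).aestronglyMeasurable
  · exact hη.integrable_mul (hu.continuous.comp (by fun_prop))
  · exact (hF.comp (by fun_prop : Continuous fun z => (t, z))).aestronglyMeasurable
  · refine Eventually.of_forall fun z s hs => ?_
    by_cases hz : z ∈ Metric.closedBall (0 : EuclideanSpace ℝ (Fin d)) 1
    · rw [indicator_of_mem hz]
      exact hB (s, z) ⟨Metric.ball_subset_closedBall hs, hz⟩
    · rw [indicator_of_notMem hz, hη.eq_zero (by simpa using hz)]
      simp
  · exact (integrable_indicator_iff measurableSet_closedBall).2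
      (integrableOn_const measure_closedBall_lt_top.ne)
  · refine Eventually.of_forall fun z s _ => HasDerivAt.mul_const ?_ _
    have h1 : HasDerivAt (fun s : ℝ => p z + s • q z) (q z) s := by
      simpa using ((hasDerivAt_id s).smul_const (q z)).const_add (p z)
    exact ((hu.differentiable (by norm_num)) _).hasFDerivAt.comp_hasDerivAt s h1

lemma integral_partialDeriv_mul (hu : ContDiff ℝ 1 u) (hη : IsTestFunction η)
    (x : EuclideanSpace ℝ (Fin d)) (r : ℝ) (i : Fin d) :
    r * ∫ z, partialDeriv i u (x + r • z) * η z = -∫ z, u (x + r • z) * partialDeriv i η z := by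
  have hd : ∀ z, HasFDerivAt (fun z => u (x + r • z)) (r • fderiv ℝ u (x + r • z)) z := by
    intro z
    have h1 : HasFDerivAt (fun z : EuclideanSpace ℝ (Fin d) => x + r • z)
        (r • ContinuousLinearMap.id ℝ (EuclideanSpace ℝ (Fin d))) z :=
      ((hasFDerivAt_id z).const_smul r).const_add x
    have h2 := ((hu.differentiable (by norm_num)) (x + r • z)).hasFDerivAt.comp z h1
    refine h2.congr_fderiv ?_
    ext v
    simp
  have hc : Continuous fun z => partialDeriv i u (x + r • z) :=
    (contDiff_partialDeriv (m := 0) hu (by norm_num) i).continuous.comp (by fun_prop)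
  have hc' : Continuous fun z => u (x + r • z) := hu.continuous.comp (by fun_prop)
  have key := integral_mul_fderiv_eq_neg_fderiv_mul_of_integrable (μ := volume)
    (f := fun z => u (x + r • z)) (g := η) (v := EuclideanSpace.single i 1) ?_
    ((hη.partialDeriv i).integrable_mul hc') (hη.integrable_mul hc')
    (fun z _ => (hd z).differentiableAt) (fun z _ => hη.differentiable z)
  · change ∫ z, u (x + r • z) * partialDeriv i η z = _ at key
    rw [key, neg_neg, ← integral_const_mul]
    refine integral_congr_ae (Eventually.of_forall fun z => ?_)
    simp [(hd z).fderiv, partialDeriv, mul_assoc]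
  · refine ((hη.integrable_mul hc).const_mul r).congr (Eventually.of_forall fun z => ?_)
    simp [(hd z).fderiv, partialDeriv, mul_assoc]

lemma integral_lap_mul (hu : ContDiff ℝ 2 u) (hη : IsTestFunction η)
    (x : EuclideanSpace ℝ (Fin d)) (r : ℝ) :
    r ^ 2 * ∫ z, lap u (x + r • z) * η z = ∫ z, u (x + r • z) * lap η z := by
  have hc2 : ∀ i, Continuous fun z => partialDeriv i (partialDeriv i u) (x + r • z) := fun i =>
    (contDiff_partialDeriv (m := 0) (contDiff_partialDeriv (m := 1) hu (by norm_num) i)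
      (by norm_num) i).continuous.comp (by fun_prop)
  have hc : Continuous fun z => u (x + r • z) := hu.continuous.comp (by fun_prop)
  simp only [lap_eq_sum, Finset.sum_mul, Finset.mul_sum]
  rw [integral_finsetSum _ fun i _ => hη.integrable_mul (hc2 i),
    integral_finsetSum _ fun i _ => ((hη.partialDeriv i).partialDeriv i).integrable_mul hc,
    Finset.mul_sum]
  refine Finset.sum_congr rfl fun i _ => ?_
  rw [pow_two, mul_assoc, integral_partialDeriv_mul
    (contDiff_partialDeriv (m := 1) hu (by norm_num) i) hη, mul_neg,
    integral_partialDeriv_mul (hu.of_le (by norm_num)) (hη.partialDeriv i), neg_neg]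

lemma hasDerivAt_integral_dilation (hu : ContDiff ℝ 2 u)
    {ψ ρ : EuclideanSpace ℝ (Fin d) → ℝ} (hψ : IsTestFunction ψ) (hρ : IsTestFunction ρ)
    (h : ∀ i z, partialDeriv i ψ z = -(z i * ρ z)) (w : List (Fin d))
    (x : EuclideanSpace ℝ (Fin d)) {r : ℝ} (hr : r ≠ 0) :
    HasDerivAt (fun r : ℝ => ∫ z, u (x + r • z) * wordDeriv w ρ z)
      (w.length / r * (∫ z, u (x + r • z) * wordDeriv w ρ z) +
        r * ∫ z, lap u (x + r • z) * wordDeriv w ψ z) r := by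
  have hu1 : ContDiff ℝ 1 u := hu.of_le (by norm_num)
  have hc : Continuous fun z => u (x + r • z) := hu.continuous.comp (by fun_prop)
  have hw := hρ.wordDeriv w
  refine (hasDerivAt_integral_comp_mul hu1 hw (continuous_const (y := x)) continuous_id
    r).congr_deriv ?_
  have e1 : ∫ z, fderiv ℝ u (x + r • id z) (id z) * wordDeriv w ρ z =
      ∑ i, ∫ z, partialDeriv i u (x + r • z) * (z i * wordDeriv w ρ z) := by
    have hc1 : ∀ i, Continuous fun z => partialDeriv i u (x + r • z) := fun i =>
      (contDiff_partialDeriv (m := 0) hu1 (by norm_num) i).continuous.comp (by fun_prop)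
    rw [← integral_finsetSum _ fun i _ => (hw.coord_mul i).integrable_mul (hc1 i)]
    refine integral_congr_ae (Eventually.of_forall fun z => ?_)
    simp only [fderiv_apply_eq_sum, id, Finset.sum_mul]
    exact Finset.sum_congr rfl fun i _ => by ring
  have e2 : r * ∑ i, ∫ z, partialDeriv i u (x + r • z) * (z i * wordDeriv w ρ z) =
      w.length * (∫ z, u (x + r • z) * wordDeriv w ρ z) +
        ∫ z, u (x + r • z) * lap (wordDeriv w ψ) z := by
    have hlap : Integrable fun z => u (x + r • z) * lap (wordDeriv w ψ) z := by
      simp only [lap_eq_sum, Finset.mul_sum]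
      exact integrable_finsetSum _ fun i _ =>
        (((hψ.wordDeriv w).partialDeriv i).partialDeriv i).integrable_mul hc
    rw [Finset.mul_sum, ← integral_const_mul,
      ← integral_add ((hw.integrable_mul hc).const_mul _) hlap]
    simp only [integral_partialDeriv_mul hu1 (hw.coord_mul _)]
    rw [Finset.sum_neg_distrib, ← integral_finsetSum _ fun i _ =>
      ((hw.coord_mul i).partialDeriv i).integrable_mul hc, ← integral_neg]
    refine integral_congr_ae (Eventually.of_forall fun z => ?_)
    simp only [← Finset.mul_sum, sum_partialDeriv_coord_mul_wordDeriv hψ hρ h w z]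
    ring
  rw [e1]
  rw [← integral_lap_mul hu (hψ.wordDeriv w)] at e2
  apply mul_left_cancel₀ hr
  rw [e2]
  field_simp

end Averages

/-- The scaled averages `r^{-|w|} ∫ u(x + rz) ∂ʷρ(z) dz`; up to sign these are the derivatives
at `x` of the mollification of `u` at scale `r`. -/
noncomputable def scaledAvg (ρ u : EuclideanSpace ℝ (Fin d) → ℝ) (w : List (Fin d))
    (x : EuclideanSpace ℝ (Fin d)) (r : ℝ) : ℝ :=
  (∫ z, u (x + r • z) * wordDeriv w ρ z) / r ^ w.length

/-- `u` is of class `C²`, and `u` and `Δu` are bounded by `M |y - c|ⁿ` on the ball `B(c, 2R)`. -/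
structure VanishesToOrder (u : EuclideanSpace ℝ (Fin d) → ℝ) (c : EuclideanSpace ℝ (Fin d))
    (n : ℕ) (R M : ℝ) : Prop where
  contDiff : ContDiff ℝ 2 u
  pos : 0 < R
  le_one : R ≤ 1
  bound_nonneg : 0 ≤ M
  bound : ∀ y, ‖y - c‖ ≤ 2 * R → |u y| ≤ M * ‖y - c‖ ^ n
  lap_bound : ∀ y, ‖y - c‖ ≤ 2 * R → |lap u y| ≤ M * ‖y - c‖ ^ n

section ScaledAvg

variable {u ψ ρ : EuclideanSpace ℝ (Fin d) → ℝ} {c : EuclideanSpace ℝ (Fin d)} {n : ℕ} {R M : ℝ}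

lemma hasDerivAt_scaledAvg (hu : ContDiff ℝ 2 u) (hψ : IsTestFunction ψ) (hρ : IsTestFunction ρ)
    (h : ∀ i z, partialDeriv i ψ z = -(z i * ρ z)) (w : List (Fin d))
    (x : EuclideanSpace ℝ (Fin d)) {r : ℝ} (hr : 0 < r) :
    HasDerivAt (scaledAvg ρ u w x)
      (r / r ^ w.length * ∫ z, lap u (x + r • z) * wordDeriv w ψ z) r := by
  refine ((hasDerivAt_integral_dilation hu hψ hρ h w x hr.ne').div (hasDerivAt_pow w.length r)
    (pow_pos hr _).ne').congr_deriv ?_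
  rcases w.length with _ | k
  · simp
  · rw [Nat.add_sub_cancel]
    field_simp
    push_cast
    ring

lemma hasDerivAt_scaledAvg_line (hu : ContDiff ℝ 1 u) (hρ : IsTestFunction ρ) (w : List (Fin d))
    (x v : EuclideanSpace ℝ (Fin d)) {r : ℝ} (hr : 0 < r) (t : ℝ) :
    HasDerivAt (fun t : ℝ => scaledAvg ρ u w (x + t • v) r)
      (-∑ i, v i * scaledAvg ρ u (i :: w) (x + t • v) r) t := by
  have hw := hρ.wordDeriv w
  have h1 := (hasDerivAt_integral_comp_mul hu hw (p := fun z => x + r • z) (q := fun _ => v)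
    (by fun_prop) continuous_const t).div_const (r ^ w.length)
  have e : ∀ (t : ℝ) z, x + r • z + t • v = x + t • v + r • z := fun t z => by abel
  simp only [e] at h1
  refine h1.congr_deriv ?_
  have hc : ∀ i, Continuous fun z => partialDeriv i u (x + t • v + r • z) := fun i =>
    (contDiff_partialDeriv (m := 0) hu (by norm_num) i).continuous.comp (by fun_prop)
  simp only [fderiv_apply_eq_sum u, Finset.sum_mul, mul_assoc]
  rw [integral_finsetSum _ fun i _ => (hw.integrable_mul (hc i)).const_mul _, Finset.sum_div,
    ← Finset.sum_neg_distrib]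
  refine Finset.sum_congr rfl fun i _ => ?_
  have h2 := integral_partialDeriv_mul hu hw (x + t • v) r i
  have h3 : ∫ z, u (x + t • v + r • z) * wordDeriv (i :: w) ρ z =
      ∫ z, u (x + t • v + r • z) * partialDeriv i (wordDeriv w ρ) z := rfl
  rw [integral_const_mul, scaledAvg, h3, ← neg_eq_iff_eq_neg.2 h2, List.length_cons, pow_succ]
  field_simp

lemma norm_add_smul_sub_le {x z : EuclideanSpace ℝ (Fin d)} {r : ℝ} (hx : ‖x - c‖ ≤ r)
    (hz : ‖z‖ ≤ 1) : ‖x + r • z - c‖ ≤ 2 * r := by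
  have hr : 0 ≤ r := (norm_nonneg _).trans hx
  calc ‖x + r • z - c‖ = ‖(x - c) + r • z‖ := by congr 1; abel
    _ ≤ ‖x - c‖ + ‖r • z‖ := norm_add_le _ _
    _ ≤ r + r := by
        rw [norm_smul, Real.norm_of_nonneg hr]
        exact add_le_add hx (mul_le_of_le_one_right hr hz)
    _ = 2 * r := by ring

lemma abs_integral_dilation_mul_le {v η : EuclideanSpace ℝ (Fin d) → ℝ} (hη : IsTestFunction η)
    (hM : 0 ≤ M) (hv : ∀ y, ‖y - c‖ ≤ 2 * R → |v y| ≤ M * ‖y - c‖ ^ n)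
    {x : EuclideanSpace ℝ (Fin d)} {r : ℝ} (hx : ‖x - c‖ ≤ r) (hrR : r ≤ R) :
    |∫ z, v (x + r • z) * η z| ≤ (M * 2 ^ n * ∫ z, |η z|) * r ^ n := by
  have := abs_integral_mul_le (u := fun z => v (x + r • z)) hη (B := M * (2 * r) ^ n) fun z hz => by
    have h1 := norm_add_smul_sub_le hx hz
    exact (hv _ (h1.trans (by linarith))).trans (by gcongr)
  refine this.trans_eq ?_
  rw [mul_pow]
  ring

namespace VanishesToOrder

lemma exists_abs_scaledAvg_le (hu : VanishesToOrder u c n R M) (hρ : IsTestFunction ρ)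
    (w : List (Fin d)) : ∃ C ≥ 0, ∀ x r, ‖x - c‖ ≤ r → 0 < r → r ≤ R →
      |scaledAvg ρ u w x r| ≤ C * r ^ n / r ^ w.length := by
  refine ⟨M * 2 ^ n * ∫ z, |wordDeriv w ρ z|, ?_, fun x r hx hr hrR => ?_⟩
  · have := hu.bound_nonneg
    have : 0 ≤ ∫ z, |wordDeriv w ρ z| := integral_nonneg fun _ => abs_nonneg _
    positivity
  · rw [scaledAvg, abs_div, abs_of_pos (pow_pos hr _)]
    gcongr
    exact abs_integral_dilation_mul_le (hρ.wordDeriv w) hu.bound_nonneg hu.bound hx hrR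

lemma exists_abs_scaledAvg_sub_le (hu : VanishesToOrder u c n R M) (hψ : IsTestFunction ψ)
    (hρ : IsTestFunction ρ) (h : ∀ i z, partialDeriv i ψ z = -(z i * ρ z)) {w : List (Fin d)}
    {j : ℕ} (hw : w.length + j = n + 1) : ∃ C ≥ 0, ∀ x s r, ‖x - c‖ ≤ s → 0 < s → s ≤ r → r ≤ R →
      |scaledAvg ρ u w x r - scaledAvg ρ u w x s| ≤ C * r ^ (j + 1) := by
  have hI : 0 ≤ ∫ z, |wordDeriv w ψ z| := integral_nonneg fun _ => abs_nonneg _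
  have hM := hu.bound_nonneg
  refine ⟨M * 2 ^ n * ∫ z, |wordDeriv w ψ z|, by positivity, fun x s r hx hs hsr hrR => ?_⟩
  set C := M * 2 ^ n * ∫ z, |wordDeriv w ψ z| with hC
  have hC0 : 0 ≤ C := by positivity
  have hr : 0 < r := hs.trans_le hsr
  have key := (convex_Icc s r).norm_image_sub_le_of_norm_hasDerivWithin_le
    (f := scaledAvg ρ u w x) (C := C * r ^ j)
    (fun t ht => (hasDerivAt_scaledAvg hu.contDiff hψ hρ h w x
      (hs.trans_le ht.1)).hasDerivWithinAt) (fun t ht => ?_) (left_mem_Icc.2 hsr)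
      (right_mem_Icc.2 hsr)
  · rw [Real.norm_eq_abs, Real.norm_of_nonneg (sub_nonneg.2 hsr)] at key
    calc _ ≤ C * r ^ j * (r - s) := key
      _ ≤ C * r ^ j * r := by gcongr; linarith
      _ = _ := by ring
  · have ht0 : 0 < t := hs.trans_le ht.1
    rw [Real.norm_eq_abs, abs_mul, abs_of_pos (by positivity)]
    calc t / t ^ w.length * |∫ z, lap u (x + t • z) * wordDeriv w ψ z|
        ≤ t / t ^ w.length * (C * t ^ n) := by
          gcongr
          exact abs_integral_dilation_mul_le (hψ.wordDeriv w) hM hu.lap_bound (hx.trans ht.1)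
            (ht.2.trans hrR)
      _ = C * (t ^ (n + 1) / t ^ w.length) := by ring
      _ = C * t ^ j := by
          rw [← hw, pow_add]; field_simp
      _ ≤ C * r ^ j := by gcongr; exact ht.2

lemma exists_tendsto_scaledAvg (hu : VanishesToOrder u c n R M) (hψ : IsTestFunction ψ)
    (hρ : IsTestFunction ρ) (h : ∀ i z, partialDeriv i ψ z = -(z i * ρ z)) {w : List (Fin d)}
    (hw : w.length ≤ n) : ∃ l, Tendsto (scaledAvg ρ u w c) (𝓝[>] 0) (𝓝 l) := by
  obtain ⟨j, hj⟩ : ∃ j, w.length + j = n + 1 := ⟨n + 1 - w.length, by omega⟩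
  obtain ⟨C, hC0, hC⟩ := hu.exists_abs_scaledAvg_sub_le hψ hρ h hj
  rw [← cauchy_map_iff_exists_tendsto, Metric.cauchy_iff]
  refine ⟨inferInstance, fun ε hε => ?_⟩
  have hlim : Tendsto (fun r : ℝ => C * r ^ (j + 1)) (𝓝[>] 0) (𝓝 0) := by
    have : Tendsto (fun r : ℝ => C * r ^ (j + 1)) (𝓝 0) (𝓝 (C * 0 ^ (j + 1))) :=
      Continuous.tendsto (by fun_prop) 0
    simpa using this.mono_left nhdsWithin_le_nhds
  obtain ⟨r, hr, hr0, hrR⟩ := ((hlim.eventually_lt_const (half_pos hε)).and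
    (Ioc_mem_nhdsGT hu.pos)).exists
  refine ⟨scaledAvg ρ u w c '' Ioc 0 r, image_mem_map (Ioc_mem_nhdsGT hr0), ?_⟩
  have hsub : ∀ s ∈ Ioc 0 r, dist (scaledAvg ρ u w c s) (scaledAvg ρ u w c r) < ε / 2 := by
    intro s hs
    rw [dist_comm, Real.dist_eq]
    exact (hC c s r (by simpa using hs.1.le) hs.1 hs.2 hrR).trans_lt hr
  rintro _ ⟨s, hs, rfl⟩ _ ⟨t, ht, rfl⟩
  calc _ ≤ _ := dist_triangle_right _ _ (scaledAvg ρ u w c r)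
    _ < ε / 2 + ε / 2 := add_lt_add (hsub s hs) (hsub t ht)
    _ = ε := add_halves ε

lemma tendsto_scaledAvg_zero (hu : VanishesToOrder u c n R M) (hρ : IsTestFunction ρ)
    {w : List (Fin d)} (hw : w.length < n) : Tendsto (scaledAvg ρ u w c) (𝓝[>] 0) (𝓝 0) := by
  obtain ⟨C, hC0, hC⟩ := hu.exists_abs_scaledAvg_le hρ w
  obtain ⟨j, rfl⟩ := Nat.exists_eq_add_of_lt hw
  refine squeeze_zero_norm' (a := fun r => C * r ^ (j + 1)) ?_ ?_
  · filter_upwards [Ioc_mem_nhdsGT hu.pos] with r hr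
    have hr0 : 0 < r := hr.1
    refine (hC c r (by simpa using hr0.le) hr0 hr.2).trans_eq ?_
    rw [add_assoc, pow_add]
    field_simp
  · have : Tendsto (fun r : ℝ => C * r ^ (j + 1)) (𝓝 0) (𝓝 (C * 0 ^ (j + 1))) :=
      Continuous.tendsto (by fun_prop) 0
    simpa using this.mono_left nhdsWithin_le_nhds

lemma exists_abs_scaledAvg_le_pow (hu : VanishesToOrder u c n R M) (hψ : IsTestFunction ψ)
    (hρ : IsTestFunction ρ) (h : ∀ i z, partialDeriv i ψ z = -(z i * ρ z))
    (hlim : ∀ w : List (Fin d), w.length = n → Tendsto (scaledAvg ρ u w c) (𝓝[>] 0) (𝓝 0))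
    (j : ℕ) (w : List (Fin d)) (hw : w.length + j = n + 1) :
    ∃ C ≥ 0, ∀ x r, ‖x - c‖ ≤ r → 0 < r → r ≤ R → |scaledAvg ρ u w x r| ≤ C * r ^ j := by
  have hR := hu.pos
  induction j generalizing w with
  | zero =>
    obtain ⟨C₁, hC₁, h₁⟩ := hu.exists_abs_scaledAvg_sub_le hψ hρ h hw
    obtain ⟨C₂, hC₂, h₂⟩ := hu.exists_abs_scaledAvg_le hρ w
    refine ⟨C₁ * R ^ (0 + 1) + C₂ * R ^ n / R ^ w.length, by positivity, fun x r hx hr hrR => ?_⟩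
    have e₁ := h₁ x r R hx hr hrR le_rfl
    have e₂ := h₂ x R (hx.trans hrR) hR le_rfl
    rw [pow_zero, mul_one]
    rw [abs_sub_comm] at e₁
    exact (sub_le_iff_le_add.1 (abs_sub_abs_le_abs_sub _ _)).trans (add_le_add e₁ e₂)
  | succ j ih =>
    choose C hC0 hC using fun i => ih (i :: w) (by simp; omega)
    obtain ⟨C₁, hC₁, h₁⟩ := hu.exists_abs_scaledAvg_sub_le hψ hρ h hw
    have hS : 0 ≤ ∑ i, C i := Finset.sum_nonneg fun i _ => hC0 i
    refine ⟨C₁ + ∑ i, C i, by positivity, fun x r hx hr hrR => ?_⟩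
    have hlim' : Tendsto (scaledAvg ρ u w c) (𝓝[>] 0) (𝓝 0) := by
      rcases (show w.length ≤ n by omega).lt_or_eq with hlt | heq
      · exact hu.tendsto_scaledAvg_zero hρ hlt
      · exact hlim w heq
    have hc : |scaledAvg ρ u w c r| ≤ C₁ * r ^ (j + 1 + 1) := by
      have h2 : Tendsto (fun s => |scaledAvg ρ u w c r - scaledAvg ρ u w c s|) (𝓝[>] 0)
          (𝓝 |scaledAvg ρ u w c r|) := by
        simpa using (tendsto_const_nhds.sub hlim').abs
      refine le_of_tendsto h2 ?_
      filter_upwards [Ioc_mem_nhdsGT hr] with s hs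
      exact h₁ c s r (by simpa using hs.1.le) hs.1 hs.2 hrR
    have hline := norm_image_sub_le_of_norm_deriv_le_segment_01'
      (f := fun t : ℝ => scaledAvg ρ u w (c + t • (x - c)) r) (C := (∑ i, C i) * r ^ (j + 1))
      (fun t _ => (hasDerivAt_scaledAvg_line (hu.contDiff.of_le (by norm_num)) hρ w c (x - c) hr
        t).hasDerivWithinAt) fun t ht => by
        rw [norm_neg]
        refine (norm_sum_le _ _).trans ?_
        rw [Finset.sum_mul]
        refine Finset.sum_le_sum fun i _ => ?_
        have hxt : ‖c + t • (x - c) - c‖ ≤ r := by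
          rw [add_sub_cancel_left, norm_smul, Real.norm_of_nonneg ht.1]
          exact (mul_le_of_le_one_left (norm_nonneg _) ht.2.le).trans hx
        rw [norm_mul]
        calc _ ≤ r * (C i * r ^ j) := mul_le_mul ((PiLp.norm_apply_le (x - c) i).trans hx)
              (hC i _ r hxt hr hrR) (abs_nonneg _) hr.le
          _ = _ := by ring
    simp only [one_smul, zero_smul, add_zero, add_sub_cancel, Real.norm_eq_abs] at hline
    have h3 : C₁ * r ^ (j + 1 + 1) ≤ C₁ * r ^ (j + 1) := by
      gcongr C₁ * ?_
      exact pow_le_pow_of_le_one hr.le (hrR.trans hu.le_one) (by omega)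
    rw [add_mul]
    linarith [abs_sub_abs_le_abs_sub (scaledAvg ρ u w x r) (scaledAvg ρ u w c r)]

lemma exists_abs_mul_integral_sub_le (hu : VanishesToOrder u c n R M) (hψ : IsTestFunction ψ)
    (hρ : IsTestFunction ρ) (h : ∀ i z, partialDeriv i ψ z = -(z i * ρ z)) :
    ∃ C ≥ 0, ∀ x r, ‖x - c‖ ≤ r → 0 < r → r ≤ R →
      |scaledAvg ρ u [] x r - u x * ∫ z, ρ z| ≤ C * r ^ (n + 2) := by
  have hI : 0 ≤ ∫ z, |ψ z| := integral_nonneg fun _ => abs_nonneg _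
  have hM := hu.bound_nonneg
  refine ⟨M * 2 ^ n * ∫ z, |ψ z|, by positivity, fun x r hx hr hrR => ?_⟩
  set C := M * 2 ^ n * ∫ z, |ψ z| with hC
  have hC0 : 0 ≤ C := by positivity
  have hcont : Tendsto (scaledAvg ρ u [] x) (𝓝[>] 0) (𝓝 (u x * ∫ z, ρ z)) := by
    have := (hasDerivAt_integral_comp_mul (hu.contDiff.of_le (by norm_num)) hρ
      (continuous_const (y := x)) continuous_id 0).continuousAt.tendsto
    simp only [zero_smul, add_zero, integral_const_mul, id] at this
    refine (this.mono_left nhdsWithin_le_nhds).congr fun s => ?_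
    simp [scaledAvg, wordDeriv]
  refine le_of_tendsto (tendsto_const_nhds.sub hcont).abs ?_
  filter_upwards [Ioc_mem_nhdsGT hr] with s hs
  have hs0 : 0 < s := hs.1
  have key := (convex_Icc s r).norm_image_sub_le_of_norm_hasDerivWithin_le
    (f := scaledAvg ρ u [] x) (C := C * r ^ (n + 1))
    (fun t ht => (hasDerivAt_scaledAvg hu.contDiff hψ hρ h [] x
      (hs0.trans_le ht.1)).hasDerivWithinAt) (fun t ht => ?_) (left_mem_Icc.2 hs.2)
      (right_mem_Icc.2 hs.2)
  · rw [Real.norm_eq_abs, Real.norm_of_nonneg (sub_nonneg.2 hs.2)] at key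
    calc _ ≤ C * r ^ (n + 1) * (r - s) := key
      _ ≤ C * r ^ (n + 1) * r := by gcongr; linarith
      _ = _ := by ring
  · have ht0 : 0 < t := hs0.trans_le ht.1
    rw [Real.norm_eq_abs, abs_mul, abs_of_pos (by positivity)]
    have := abs_integral_mul_le (u := fun z => lap u (x + t • z)) hψ (B := M * (2 * r) ^ n)
      fun z hz => by
        have h1 : ‖x + t • z - c‖ ≤ 2 * r := by
          have := norm_add_smul_sub_le (c := c) (z := (t / r) • z) hx (by
            rw [norm_smul, Real.norm_of_nonneg (by positivity)]
            exact mul_le_one₀ ((div_le_one hr).2 ht.2) (norm_nonneg _) hz)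
          rwa [smul_smul, mul_div_cancel₀ _ hr.ne'] at this
        exact (hu.lap_bound _ (h1.trans (by linarith))).trans (by gcongr)
    calc t / t ^ ([] : List (Fin d)).length * |∫ z, lap u (x + t • z) * wordDeriv [] ψ z|
        ≤ r * (M * (2 * r) ^ n * ∫ z, |ψ z|) := by
          simp only [List.length_nil, pow_zero, div_one]
          exact mul_le_mul ht.2 this (abs_nonneg _) hr.le
      _ = C * r ^ (n + 1) := by rw [hC, mul_pow]; ring

/-- If all limits of scaled averages of order `n` vanish, the vanishing order improves. -/
theorem isBigO_succ (hu : VanishesToOrder u c n R M) (hψ : IsTestFunction ψ)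
    (hρ : IsTestFunction ρ) (h : ∀ i z, partialDeriv i ψ z = -(z i * ρ z))
    (hpos : 0 < ∫ z, ρ z)
    (hlim : ∀ w : List (Fin d), w.length = n → Tendsto (scaledAvg ρ u w c) (𝓝[>] 0) (𝓝 0)) :
    u =O[𝓝 c] fun y => ‖y - c‖ ^ (n + 1) := by
  obtain ⟨C₁, hC₁, h₁⟩ := hu.exists_abs_scaledAvg_le_pow hψ hρ h hlim (n + 1) [] (by simp)
  obtain ⟨C₂, hC₂, h₂⟩ := hu.exists_abs_mul_integral_sub_le hψ hρ h
  refine IsBigO.of_bound ((C₁ + C₂) / ∫ z, ρ z) ?_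
  filter_upwards [Metric.ball_mem_nhds c hu.pos] with x hx
  rw [mem_ball_iff_norm] at hx
  have hle : ∀ᶠ r in 𝓝[>] ‖x - c‖, |u x| ≤ (C₁ + C₂) / (∫ z, ρ z) * r ^ (n + 1) := by
    filter_upwards [Ioc_mem_nhdsGT hx] with r hr
    have hr0 : 0 < r := (norm_nonneg _).trans_lt hr.1
    have e₁ := h₁ x r hr.1.le hr0 hr.2
    have e₂ := h₂ x r hr.1.le hr0 hr.2
    have e₃ : C₂ * r ^ (n + 2) ≤ C₂ * r ^ (n + 1) := by
      gcongr C₂ * ?_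
      exact pow_le_pow_of_le_one hr0.le (hr.2.trans hu.le_one) (by omega)
    rw [abs_sub_comm] at e₂
    have e₄ := abs_sub_abs_le_abs_sub (u x * ∫ z, ρ z) (scaledAvg ρ u [] x r)
    rw [abs_mul, abs_of_pos hpos] at e₄
    rw [div_mul_eq_mul_div, le_div_iff₀ hpos]
    linarith
  have ht : Tendsto (fun r : ℝ => (C₁ + C₂) / (∫ z, ρ z) * r ^ (n + 1)) (𝓝[>] ‖x - c‖)
      (𝓝 ((C₁ + C₂) / (∫ z, ρ z) * ‖x - c‖ ^ (n + 1))) :=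
    (Continuous.tendsto (by fun_prop) _).mono_left nhdsWithin_le_nhds
  simpa using ge_of_tendsto ht hle

end VanishesToOrder

end ScaledAvg

section Words

variable {u ψ ρ : EuclideanSpace ℝ (Fin d) → ℝ} {c : EuclideanSpace ℝ (Fin d)} {n : ℕ} {R M : ℝ}

lemma scaledAvg_perm (hρ : IsTestFunction ρ) {v w : List (Fin d)} (h : v.Perm w) :
    scaledAvg ρ u v c = scaledAvg ρ u w c := by
  ext r
  rw [scaledAvg, scaledAvg, wordDeriv_perm hρ.contDiff h, h.length_eq]

namespace VanishesToOrder

lemma tendsto_sum_scaledAvg (hu : VanishesToOrder u c n R M) (hρ : IsTestFunction ρ)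
    {v : List (Fin d)} (hv : v.length + 2 = n) :
    Tendsto (fun r => ∑ i, scaledAvg ρ u (i :: i :: v) c r) (𝓝[>] 0) (𝓝 0) := by
  have hρv := hρ.wordDeriv v
  set C := M * 2 ^ n * ∫ z, |wordDeriv v ρ z|
  refine squeeze_zero_norm' (a := fun r => C * r ^ 2) ?_ ?_
  · filter_upwards [Ioc_mem_nhdsGT hu.pos] with r hr
    have hr0 : 0 < r := hr.1
    have hc : Continuous fun z => u (c + r • z) := hu.contDiff.continuous.comp (by fun_prop)
    have e : ∑ i, scaledAvg ρ u (i :: i :: v) c r =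
        r ^ 2 * (∫ z, lap u (c + r • z) * wordDeriv v ρ z) / r ^ n := by
      rw [integral_lap_mul hu.contDiff hρv]
      simp only [lap_eq_sum, Finset.mul_sum]
      rw [integral_finsetSum _ fun i _ =>
        ((hρv.partialDeriv i).partialDeriv i).integrable_mul hc, Finset.sum_div]
      refine Finset.sum_congr rfl fun i _ => ?_
      rw [scaledAvg, List.length_cons, List.length_cons, add_assoc, one_add_one_eq_two, hv]
      rfl
    rw [e, Real.norm_eq_abs, abs_div, abs_mul, abs_of_pos (pow_pos hr0 n),
      abs_of_pos (pow_pos hr0 2), div_le_iff₀ (pow_pos hr0 n)]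
    have := abs_integral_dilation_mul_le hρv hu.bound_nonneg hu.lap_bound (x := c) (r := r)
      (by simpa using hr0.le) hr.2
    calc _ ≤ r ^ 2 * (C * r ^ n) := by gcongr
      _ = _ := by ring
  · have : Tendsto (fun r : ℝ => C * r ^ 2) (𝓝 0) (𝓝 (C * 0 ^ 2)) :=
      Continuous.tendsto (by fun_prop) 0
    simpa using this.mono_left nhdsWithin_le_nhds

/-- It suffices to control the words containing a fixed letter `k` at most once. -/
lemma tendsto_scaledAvg_of_count_le_one (hu : VanishesToOrder u c n R M) (hρ : IsTestFunction ρ)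
    (k : Fin d) (hlim : ∀ w : List (Fin d), w.length = n → w.count k ≤ 1 →
      Tendsto (scaledAvg ρ u w c) (𝓝[>] 0) (𝓝 0)) (w : List (Fin d)) (hw : w.length = n) :
    Tendsto (scaledAvg ρ u w c) (𝓝[>] 0) (𝓝 0) := by
  induction hm : w.count k using Nat.strong_induction_on generalizing w with
  | _ m ih =>
    rcases le_or_gt (w.count k) 1 with hle | hgt
    · exact hlim w hw hle
    · have hk : k ∈ w := List.count_pos_iff.1 (by omega)
      have hc1 := List.count_erase_self (a := k) (l := w)
      have hk' : k ∈ w.erase k := List.count_pos_iff.1 (by omega)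
      set v := (w.erase k).erase k with hv
      have hperm : w.Perm (k :: k :: v) :=
        (List.perm_cons_erase hk).trans ((List.perm_cons_erase hk').cons k)
      have hlen : v.length + 2 = n := by
        rw [← hw, hperm.length_eq]; simp
      have hcount : w.count k = v.count k + 2 := by
        rw [hperm.count_eq]; simp
      have hsum := hu.tendsto_sum_scaledAvg hρ hlen
      have hrest : Tendsto (fun r => ∑ i ∈ Finset.univ.erase k, scaledAvg ρ u (i :: i :: v) c r)
          (𝓝[>] 0) (𝓝 0) := by
        have := tendsto_finsetSum (f := fun i r => scaledAvg ρ u (i :: i :: v) c r)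
          (a := fun _ => 0) (x := 𝓝[>] 0) (Finset.univ.erase k) fun i hi => by
            have hik : i ≠ k := (Finset.mem_erase.1 hi).1
            have hc : (i :: i :: v).count k = v.count k := by
              rw [List.count_cons_of_ne hik, List.count_cons_of_ne hik]
            exact ih _ (by omega) _ (by simpa using hlen) hc
        simpa using this
      rw [scaledAvg_perm hρ hperm]
      have := hsum.sub hrest
      rw [sub_zero] at this
      refine this.congr fun r => ?_
      rw [← Finset.add_sum_erase _ _ (Finset.mem_univ k)]
      ring

end VanishesToOrder

/-- A word in which the letter `i` occurs `α i` times. -/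
noncomputable def canonicalWord (α : Fin d → ℕ) : List (Fin d) :=
  (∑ i, Multiset.replicate (α i) i).toList

lemma count_canonicalWord (α : Fin d → ℕ) (i : Fin d) : (canonicalWord α).count i = α i := by
  rw [← Multiset.coe_count, canonicalWord, Multiset.coe_toList, Multiset.count_sum']
  simp [Multiset.count_replicate]

lemma length_canonicalWord (α : Fin d → ℕ) : (canonicalWord α).length = ∑ i, α i := by
  simp [canonicalWord]

lemma perm_canonicalWord (w : List (Fin d)) : w.Perm (canonicalWord fun i => w.count i) :=
  List.perm_iff_count.2 fun i => (count_canonicalWord (fun i => w.count i) i).symm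

/-- Multi-indices with entries at most `N` whose entry at `0` is at most `1`. -/
def indexBox (d N : ℕ) [NeZero d] : Finset (Fin d → ℕ) :=
  Fintype.piFinset fun i => if i = 0 then Finset.range 2 else Finset.range (N + 1)

lemma card_indexBox (d N : ℕ) [NeZero d] : (indexBox d N).card = 2 * (N + 1) ^ (d - 1) := by
  have h : ∀ i : Fin d, (if i = 0 then Finset.range 2 else Finset.range (N + 1)).card =
      if i = 0 then 2 else N + 1 := fun i => by split_ifs <;> simp
  rw [indexBox, Fintype.card_piFinset, Finset.prod_congr rfl fun i _ => h i,
    ← Finset.mul_prod_erase _ _ (Finset.mem_univ 0), Finset.prod_congr rfl fun i hi =>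
      if_neg (Finset.mem_erase.1 hi).1]
  simp

lemma count_mem_indexBox [NeZero d] {N : ℕ} {w : List (Fin d)} (hw : w.length ≤ N)
    (h0 : w.count 0 ≤ 1) : (fun i => w.count i) ∈ indexBox d N := by
  rw [indexBox, Fintype.mem_piFinset]
  intro i
  have := (List.count_le_length (a := i) (l := w)).trans hw
  split_ifs with hi
  · subst hi; simp; omega
  · simp; omega

end Words

section Dimension

variable {V : Type*} [AddCommGroup V] [Module ℝ V]

lemma scaledAvg_add {ρ u v : EuclideanSpace ℝ (Fin d) → ℝ} (hρ : IsTestFunction ρ)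
    (hu : Continuous u) (hv : Continuous v) (w : List (Fin d)) (x : EuclideanSpace ℝ (Fin d))
    (r : ℝ) : scaledAvg ρ (u + v) w x r = scaledAvg ρ u w x r + scaledAvg ρ v w x r := by
  have hu' : Continuous fun z => u (x + r • z) := hu.comp (by fun_prop)
  have hv' : Continuous fun z => v (x + r • z) := hv.comp (by fun_prop)
  simp only [scaledAvg, Pi.add_apply, add_mul]
  rw [integral_add ((hρ.wordDeriv w).integrable_mul hu') ((hρ.wordDeriv w).integrable_mul hv'),
    add_div]

lemma scaledAvg_smul (ρ u : EuclideanSpace ℝ (Fin d) → ℝ) (a : ℝ) (w : List (Fin d))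
    (x : EuclideanSpace ℝ (Fin d)) (r : ℝ) :
    scaledAvg ρ (a • u) w x r = a * scaledAvg ρ u w x r := by
  simp only [scaledAvg, Pi.smul_apply, smul_eq_mul, mul_assoc]
  rw [integral_const_mul, mul_div_assoc]

lemma exists_vanishesToOrder {u : EuclideanSpace ℝ (Fin d) → ℝ} {c : EuclideanSpace ℝ (Fin d)}
    {n : ℕ} {K : ℝ} (hu : ContDiff ℝ 2 u) (hK : ∀ᶠ y in 𝓝 c, |lap u y| ≤ K * |u y|)
    (hn : u =O[𝓝 c] fun y => ‖y - c‖ ^ n) : ∃ R M, VanishesToOrder u c n R M := by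
  obtain ⟨M, hM0, hM⟩ := hn.exists_nonneg
  obtain ⟨ε, hε, hball⟩ := Metric.eventually_nhds_iff.1 (hK.and hM.bound)
  have hlt : ∀ y, ‖y - c‖ ≤ 2 * min 1 (ε / 4) → dist y c < ε := fun y hy => by
    rw [dist_eq_norm]
    linarith [min_le_right 1 (ε / 4)]
  have h1 : ∀ y, ‖y - c‖ ≤ 2 * min 1 (ε / 4) → |u y| ≤ M * ‖y - c‖ ^ n := fun y hy => by
    simpa using (hball (hlt y hy)).2
  have hmax := le_max_right (|K| * M) M
  refine ⟨min 1 (ε / 4), max (|K| * M) M, hu, by positivity, min_le_left _ _, hM0.trans hmax,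
    fun y hy => (h1 y hy).trans (by gcongr), fun y hy => ?_⟩
  calc |lap u y| ≤ K * |u y| := (hball (hlt y hy)).1
    _ ≤ |K| * (M * ‖y - c‖ ^ n) := by
        gcongr
        · exact le_abs_self K
        · exact h1 y hy
    _ = (|K| * M) * ‖y - c‖ ^ n := by ring
    _ ≤ _ := by gcongr; exact le_max_left _ _

variable [FiniteDimensional ℝ V] [NeZero d]

/-- Passing from vanishing order `n` to `n + 1` costs at most as many dimensions as there are
multi-indices of order `n` in the index box. -/
lemma exists_submodule_isBigO_succ (T : V →ₗ[ℝ] (EuclideanSpace ℝ (Fin d) → ℝ))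
    {c : EuclideanSpace ℝ (Fin d)} {K : ℝ} (hT : ∀ v, ContDiff ℝ 2 (T v))
    (hK : ∀ v, ∀ᶠ y in 𝓝 c, |lap (T v) y| ≤ K * |T v y|) {n N : ℕ} (hnN : n ≤ N)
    (S : Submodule ℝ V) (hS : ∀ v ∈ S, T v =O[𝓝 c] fun y => ‖y - c‖ ^ n) :
    ∃ S' ≤ S, (∀ v ∈ S', T v =O[𝓝 c] fun y => ‖y - c‖ ^ (n + 1)) ∧
      Module.finrank ℝ S ≤
        Module.finrank ℝ S' + ((indexBox d N).filter fun α => ∑ i, α i = n).card := by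
  obtain ⟨ψ, ρ, hψ, hρ, hψρ, hpos⟩ := exists_test_pair d
  set I := (indexBox d N).filter fun α => ∑ i, α i = n with hI
  have hex : ∀ v : S, ∀ α : I, ∃ l,
      Tendsto (scaledAvg ρ (T v) (canonicalWord α.1) c) (𝓝[>] 0) (𝓝 l) := by
    intro v α
    obtain ⟨R, M, hv⟩ := exists_vanishesToOrder (hT v) (hK v) (hS v v.2)
    refine hv.exists_tendsto_scaledAvg hψ hρ hψρ ?_
    rw [length_canonicalWord, (Finset.mem_filter.1 α.2).2]
  choose l hl using hex
  let L : S →ₗ[ℝ] (I → ℝ) :=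
    { toFun := l
      map_add' := fun v w => funext fun α => by
        refine tendsto_nhds_unique (hl (v + w) α) (((hl v α).add (hl w α)).congr fun r => ?_)
        rw [Submodule.coe_add, map_add,
          scaledAvg_add hρ (hT v).continuous (hT w).continuous]
      map_smul' := fun a v => funext fun α => by
        refine tendsto_nhds_unique (hl (a • v) α) (((hl v α).const_mul a).congr fun r => ?_)
        rw [Submodule.coe_smul, map_smul, scaledAvg_smul] }
  refine ⟨(LinearMap.ker L).map S.subtype, Submodule.map_subtype_le _ _, ?_, ?_⟩
  · rintro _ ⟨v, hv, rfl⟩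
    obtain ⟨R, M, hvan⟩ := exists_vanishesToOrder (hT v) (hK v) (hS v v.2)
    refine hvan.isBigO_succ hψ hρ hψρ hpos
      (hvan.tendsto_scaledAvg_of_count_le_one hρ 0 fun w hw h0 => ?_)
    have hlen : ∑ i, w.count i = n := by
      rw [← length_canonicalWord, ← (perm_canonicalWord w).length_eq, hw]
    have hmem : (fun i => w.count i) ∈ I :=
      Finset.mem_filter.2 ⟨count_mem_indexBox (hw.trans_le hnN) h0, hlen⟩
    have h1 := hl v ⟨_, hmem⟩
    rw [← scaledAvg_perm hρ (perm_canonicalWord w)] at h1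
    have h2 : l v = 0 := hv
    rwa [h2] at h1
  · have h1 := L.finrank_range_add_finrank_ker
    have h2 := (LinearMap.range L).finrank_le
    rw [Module.finrank_pi, Fintype.card_coe] at h2
    rw [Submodule.finrank_map_subtype_eq]
    omega

theorem exists_submodule_isBigO (T : V →ₗ[ℝ] (EuclideanSpace ℝ (Fin d) → ℝ))
    {c : EuclideanSpace ℝ (Fin d)} {K : ℝ} (hT : ∀ v, ContDiff ℝ 2 (T v))
    (hK : ∀ v, ∀ᶠ y in 𝓝 c, |lap (T v) y| ≤ K * |T v y|) (N : ℕ) :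
    ∃ S : Submodule ℝ V, (∀ v ∈ S, T v =O[𝓝 c] fun y => ‖y - c‖ ^ (N + 1)) ∧
      Module.finrank ℝ V ≤ Module.finrank ℝ S + 2 * (N + 1) ^ (d - 1) := by
  have key : ∀ n ≤ N + 1, ∃ S : Submodule ℝ V, (∀ v ∈ S, T v =O[𝓝 c] fun y => ‖y - c‖ ^ n) ∧
      Module.finrank ℝ V ≤
        Module.finrank ℝ S + ((indexBox d N).filter fun α => ∑ i, α i < n).card := by
    intro n hn
    induction n with
    | zero =>
      refine ⟨⊤, fun v _ => ?_, by simp⟩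
      simpa using ((hT v).continuous.continuousAt (x := c)).tendsto.isBigO_one ℝ
    | succ n ih =>
      obtain ⟨S, hS, hdim⟩ := ih (by omega)
      obtain ⟨S', -, hS', hdim'⟩ := exists_submodule_isBigO_succ T hT hK (N := N) (by omega) S hS
      refine ⟨S', hS', ?_⟩
      have : ((indexBox d N).filter fun α => ∑ i, α i < n + 1).card =
          ((indexBox d N).filter fun α => ∑ i, α i < n).card +
            ((indexBox d N).filter fun α => ∑ i, α i = n).card := by
        simp only [Nat.lt_succ_iff_lt_or_eq, Finset.filter_or]
        exact Finset.card_union_of_disjoint (Finset.disjoint_filter.2 fun α _ h => h.ne)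
      omega
  obtain ⟨S, hS, hdim⟩ := key (N + 1) le_rfl
  refine ⟨S, hS, hdim.trans (Nat.add_le_add_left ?_ _)⟩
  rw [← card_indexBox]
  exact Finset.card_filter_le _ _

end Dimension

section Cutoff

lemma lap_congr {f g : EuclideanSpace ℝ (Fin d) → ℝ} {x : EuclideanSpace ℝ (Fin d)}
    (h : f =ᶠ[𝓝 x] g) : lap f x = lap g x := by
  refine Finset.sum_congr rfl fun i _ => ?_
  have : (fun y => fderiv ℝ f y (EuclideanSpace.single i 1)) =ᶠ[𝓝 x]
      fun y => fderiv ℝ g y (EuclideanSpace.single i 1) :=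
    (h.fderiv (𝕜 := ℝ)).mono fun y hy => congrArg (fun A => A (EuclideanSpace.single i 1)) hy
  rw [this.fderiv_eq]

lemma contDiff_contDiffBump_mul {c : EuclideanSpace ℝ (Fin d)} (χ : ContDiffBump c) {R : ℝ}
    (hR : χ.rOut < R) {f : EuclideanSpace ℝ (Fin d) → ℝ}
    (hf : ContDiffOn ℝ 2 f (Metric.ball c R)) : ContDiff ℝ 2 (⇑χ * f) := by
  rw [contDiff_iff_contDiffAt]
  intro y
  by_cases hy : y ∈ Metric.ball c R
  · exact χ.contDiff.contDiffAt.mul (hf.contDiffAt (Metric.isOpen_ball.mem_nhds hy))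
  · have hy' : y ∉ tsupport χ := by
      rw [χ.tsupport_eq, Metric.mem_closedBall, not_le]
      exact hR.trans_le (not_lt.1 hy)
    refine (contDiffAt_const (c := (0 : ℝ))).congr_of_eventuallyEq ?_
    filter_upwards [notMem_tsupport_iff_eventuallyEq.1 hy'] with z hz
    simp [hz]

lemma abs_lap_le_of_ae {f : EuclideanSpace ℝ (Fin d) → ℝ} (hf : ContDiff ℝ 2 f)
    {U : Set (EuclideanSpace ℝ (Fin d))} (hU : IsOpen U) {K : ℝ}
    (h : ∀ᵐ y, y ∈ U → |lap f y| ≤ K * |f y|) : ∀ y ∈ U, |lap f y| ≤ K * |f y| := by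
  have hopen : IsOpen (U ∩ {y | K * |f y| < |lap f y|}) :=
    hU.inter (isOpen_lt (continuous_const.mul hf.continuous.abs) (continuous_lap hf).abs)
  have hnull : volume (U ∩ {y | K * |f y| < |lap f y|}) = 0 := by
    refine measure_mono_null (fun y hy => ?_) (ae_iff.1 h)
    simpa using hy
  have hempty := (hopen.measure_eq_zero_iff volume).1 hnull
  intro y hy
  by_contra! hlt
  exact (hempty ▸ (⟨hy, hlt⟩ : y ∈ U ∩ {y | K * |f y| < |lap f y|}) : y ∈ (∅ : Set _))

/-- A finite-dimensional space of solutions near `c` contains a subspace of solutions of vanishing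
order at least `N + 1` whose codimension is at most `2 (N + 1) ^ (d - 1)`. -/
theorem exists_submodule_le_solSetN [NeZero d] {c : EuclideanSpace ℝ (Fin d)} {R K : ℝ}
    (hR : 0 < R) {W : EuclideanSpace ℝ (Fin d) → ℝ} (hW : ∀ x ∈ Metric.ball c R, |W x| ≤ K)
    (J : Submodule ℝ (EuclideanSpace ℝ (Fin d) → ℝ)) [FiniteDimensional ℝ J]
    (hJ : (J : Set (EuclideanSpace ℝ (Fin d) → ℝ)) ⊆ solSet (Metric.ball c R) W) (N : ℕ) :
    ∃ J' ≤ J, (J' : Set (EuclideanSpace ℝ (Fin d) → ℝ)) ⊆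
        solSetN (Metric.ball c R) W c (N + 1) ∧
      Module.finrank ℝ J ≤ Module.finrank ℝ J' + 2 * (N + 1) ^ (d - 1) := by
  let χ : ContDiffBump c := ⟨R / 3, R / 2, by positivity, by linarith⟩
  let T : J →ₗ[ℝ] (EuclideanSpace ℝ (Fin d) → ℝ) := LinearMap.mulLeft ℝ (⇑χ) ∘ₗ J.subtype
  have hT : ∀ φ, ContDiff ℝ 2 (T φ) := fun φ =>
    contDiff_contDiffBump_mul χ (show R / 2 < R by linarith) (hJ φ.2).1
  have hTeq : ∀ φ, ∀ y ∈ Metric.ball c (R / 3), T φ =ᶠ[𝓝 y] φ := fun φ y hy => by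
    filter_upwards [χ.eventuallyEq_one_of_mem_ball hy] with z hz
    simp [T, hz]
  have hc : c ∈ Metric.ball c (R / 3) := Metric.mem_ball_self (by positivity)
  have hK : ∀ φ, ∀ᶠ y in 𝓝 c, |lap (T φ) y| ≤ K * |T φ y| := fun φ => by
    refine Filter.mem_of_superset (Metric.isOpen_ball.mem_nhds hc)
      (abs_lap_le_of_ae (hT φ) Metric.isOpen_ball ?_)
    filter_upwards [(hJ φ.2).2.2] with y hy hyc
    have hyR : y ∈ Metric.ball c R := Metric.ball_subset_ball (by linarith) hyc
    rw [lap_congr (hTeq φ y hyc), (hTeq φ y hyc).eq_of_nhds, hy hyR, abs_mul]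
    exact mul_le_mul_of_nonneg_right (hW y hyR) (abs_nonneg _)
  obtain ⟨S, hS, hdim⟩ := exists_submodule_isBigO T hT hK N
  refine ⟨S.map J.subtype, Submodule.map_subtype_le _ _, ?_, ?_⟩
  · rintro _ ⟨φ, hφ, rfl⟩
    refine ⟨hJ φ.2, ?_⟩
    obtain ⟨M, hM⟩ := ((hTeq φ c hc).symm.trans_isBigO (hS φ hφ)).bound
    exact ⟨M, (hM.filter_mono nhdsWithin_le_nhds).mono fun y hy => by simpa using hy⟩
  · rwa [Submodule.finrank_map_subtype_eq]

end Cutoff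

end VanishingOrder

/-- For `d ≥ 2` there is `γ_d > 0` such that for every ball
`Ω = B(x₀, 3r₀)`, every bounded measurable `W`, every finite-dimensional subspace `J` of
`E₀(Ω)` and every `N ∈ ℕ`, the subspace `J ∩ E_{N+1}(Ω)` has dimension at least
`dim J - γ_d N^{d-1}`.  (The intersection is realized as a subspace `J' ≤ J` whose
elements all lie in `E_{N+1}(Ω)`.) -/
theorem dim_intersection_vanishing_order (d : ℕ) (hd : 2 ≤ d) :
    ∃ γ > (0 : ℝ),
      ∀ (x₀ : EuclideanSpace ℝ (Fin d)) (r₀ : ℝ), 0 < r₀ →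
      ∀ (W : EuclideanSpace ℝ (Fin d) → ℝ) (Winf : ℝ), Measurable W →
        (∀ x ∈ Metric.ball x₀ (3 * r₀), |W x| ≤ Winf) →
      ∀ J : Submodule ℝ (EuclideanSpace ℝ (Fin d) → ℝ), FiniteDimensional ℝ J →
        (↑J : Set (EuclideanSpace ℝ (Fin d) → ℝ)) ⊆ solSet (Metric.ball x₀ (3 * r₀)) W →
      ∀ N : ℕ, 1 ≤ N →
        ∃ J' : Submodule ℝ (EuclideanSpace ℝ (Fin d) → ℝ), J' ≤ J ∧
          (↑J' : Set (EuclideanSpace ℝ (Fin d) → ℝ)) ⊆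
            solSetN (Metric.ball x₀ (3 * r₀)) W x₀ (N + 1) ∧
          (Module.finrank ℝ J : ℝ) - γ * (N : ℝ) ^ (d - 1) ≤
            (Module.finrank ℝ J' : ℝ) := by
  have : NeZero d := ⟨by omega⟩
  refine ⟨2 ^ d, by positivity, fun x₀ r₀ hr₀ W Winf _ hW J _ hJ N hN => ?_⟩
  obtain ⟨J', hJ'J, hJ', hdim⟩ :=
    VanishingOrder.exists_submodule_le_solSetN (by positivity) hW J hJ N
  refine ⟨J', hJ'J, hJ', ?_⟩
  have hle : 2 * (N + 1) ^ (d - 1) ≤ 2 ^ d * N ^ (d - 1) :=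
    calc 2 * (N + 1) ^ (d - 1) ≤ 2 * (2 * N) ^ (d - 1) := by gcongr; omega
      _ = 2 ^ (d - 1 + 1) * N ^ (d - 1) := by ring
      _ = 2 ^ d * N ^ (d - 1) := by rw [Nat.sub_add_cancel (by omega)]
  have := hdim.trans (Nat.add_le_add_left hle _)
  rw [sub_le_iff_le_add]
  exact_mod_cast this
end

section
/- Let d ≥ 1. There exists a constant m > 0, depending only on d, with the following property (quantitative unique continuation principle). Let Ω ⊆ ℝ^d be open, let V : Ω → ℝ be measurable with ‖V‖_∞ ≤ K < ∞, let ψ : Ω → ℝ be twice continuously differentiable with ‖ψ_Ω‖₂ < ∞, and set ζ := −Δψ + Vψ (pointwise on Ω), assuming ‖ζ_Ω‖₂ < ∞. Let Θ ⊆ Ω be a bounded measurable set with ‖ψ_Θ‖₂ > 0, and let x₀ ∈ Ω ∖ closure(Θ) be such that Q := sup_{y∈Θ} |y−x₀| ≥ 1 and B(x₀, 6Q+2) ⊆ Ω. Then for every δ with 0 < δ ≤ min{dist(x₀, Θ), 1/24}: (δ/Q)^{m(1+K^{2/3})(Q^{4/3} + log(‖ψ_Ω‖₂/‖ψ_Θ‖₂))}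 · ‖ψ_Θ‖₂² ≤ ‖ψ_{B(x₀,δ)}‖₂² + δ² ‖ζ_Ω‖₂². -/
open MeasureTheory

/-- The partial derivative `∂f/∂x_i`. -/
noncomputable def pd {d : ℕ} (i : Fin d) (f : EuclideanSpace ℝ (Fin d) → ℝ)
    (x : EuclideanSpace ℝ (Fin d)) : ℝ :=
  fderiv ℝ f x (EuclideanSpace.single i 1)

section Calculus

variable {d : ℕ} {f g : EuclideanSpace ℝ (Fin d) → ℝ} {x : EuclideanSpace ℝ (Fin d)}

lemma lap_eq_sum_pd (f : EuclideanSpace ℝ (Fin d) → ℝ) (x : EuclideanSpace ℝ (Fin d)) :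
    lap f x = ∑ i, pd i (pd i f) x := rfl

lemma pd_congr (h : f =ᶠ[nhds x] g) (i : Fin d) : pd i f x = pd i g x := by
  simp only [pd, h.fderiv_eq]

lemma pd_eventuallyEq (h : f =ᶠ[nhds x] g) (i : Fin d) : pd i f =ᶠ[nhds x] pd i g := by
  filter_upwards [h.eventuallyEq_nhds] with y hy using pd_congr hy i

lemma lap_congr (h : f =ᶠ[nhds x] g) : lap f x = lap g x := by
  simp only [lap_eq_sum_pd]
  exact Finset.sum_congr rfl fun i _ => pd_congr (pd_eventuallyEq h i) i

lemma pd_zero (i : Fin d) (x : EuclideanSpace ℝ (Fin d)) : pd i (fun _ => 0) x = 0 := by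
  simp [pd]

lemma pd_add (hf : DifferentiableAt ℝ f x) (hg : DifferentiableAt ℝ g x) (i : Fin d) :
    pd i (fun y => f y + g y) x = pd i f x + pd i g x := by
  simp [pd, fderiv_fun_add hf hg]

lemma pd_sub (hf : DifferentiableAt ℝ f x) (hg : DifferentiableAt ℝ g x) (i : Fin d) :
    pd i (fun y => f y - g y) x = pd i f x - pd i g x := by
  simp [pd, fderiv_fun_sub hf hg]

lemma pd_mul (hf : DifferentiableAt ℝ f x) (hg : DifferentiableAt ℝ g x) (i : Fin d) :
    pd i (fun y => f y * g y) x = pd i f x * g x + f x * pd i g x := by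
  simp [pd, fderiv_fun_mul hf hg]
  ring

lemma pd_sum {ι : Type*} {s : Finset ι} {F : ι → EuclideanSpace ℝ (Fin d) → ℝ}
    (hF : ∀ j ∈ s, DifferentiableAt ℝ (F j) x) (i : Fin d) :
    pd i (fun y => ∑ j ∈ s, F j y) x = ∑ j ∈ s, pd i (F j) x := by
  simp [pd, fderiv_fun_sum hF]

lemma pd_coord (i j : Fin d) (x : EuclideanSpace ℝ (Fin d)) :
    pd i (fun y => y j) x = if j = i then 1 else 0 := by
  have : HasFDerivAt (fun y : EuclideanSpace ℝ (Fin d) => y j)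
      (EuclideanSpace.proj j : EuclideanSpace ℝ (Fin d) →L[ℝ] ℝ) x :=
    (EuclideanSpace.proj j : EuclideanSpace ℝ (Fin d) →L[ℝ] ℝ).hasFDerivAt
  simp [pd, this.fderiv]

lemma pd_radial {A : ℝ → ℝ} {A' : ℝ} (hA : HasDerivAt A A' (‖x‖ ^ 2)) (i : Fin d) :
    pd i (fun y => A (‖y‖ ^ 2)) x = 2 * A' * x i := by
  have h1 := hA.comp_hasFDerivAt x (hasStrictFDerivAt_norm_sq x).hasFDerivAt
  have h2 : HasFDerivAt (fun y : EuclideanSpace ℝ (Fin d) => A (‖y‖ ^ 2)) _ x := h1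
  simp [pd, h2.fderiv, EuclideanSpace.inner_single_right]
  ring

lemma pd_comp_smul (hf : Differentiable ℝ f) (r : ℝ) (i : Fin d)
    (x : EuclideanSpace ℝ (Fin d)) :
    pd i (fun y => f (r • y)) x = r * pd i f (r • x) := by
  have h1 : HasFDerivAt (fun y : EuclideanSpace ℝ (Fin d) => r • y)
      (r • ContinuousLinearMap.id ℝ (EuclideanSpace ℝ (Fin d))) x :=
    (hasFDerivAt_id x).const_smul r
  have h2 : HasFDerivAt (fun y => f (r • y)) _ x :=
    (hf (r • x)).hasFDerivAt.comp x h1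
  simp [pd, h2.fderiv]

lemma pd_comp_add (c : EuclideanSpace ℝ (Fin d)) (i : Fin d) :
    pd i (fun y => f (c + y)) x = pd i f (c + x) := by
  simp [pd, fderiv_comp_add_left]

lemma lap_comp_add (c : EuclideanSpace ℝ (Fin d)) :
    lap (fun y => f (c + y)) x = lap f (c + x) := by
  simp only [lap_eq_sum_pd]
  refine Finset.sum_congr rfl fun i _ => ?_
  have : pd i (fun y => f (c + y)) = fun y => pd i f (c + y) := by
    funext y; exact pd_comp_add c i
  rw [this, pd_comp_add c i]

lemma contDiff_pd {n m : WithTop ℕ∞} (hf : ContDiff ℝ n f) (hm : m + 1 ≤ n) (i : Fin d) :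
    ContDiff ℝ m (pd i f) :=
  (hf.fderiv_right hm).clm_apply contDiff_const

lemma contDiff_one_pd (hf : ContDiff ℝ 2 f) (i : Fin d) : ContDiff ℝ 1 (pd i f) :=
  contDiff_pd hf (by norm_num) i

lemma continuous_pd (hf : ContDiff ℝ 1 f) (i : Fin d) : Continuous (pd i f) :=
  (contDiff_pd (m := 0) hf (by norm_num) i).continuous

lemma continuous_lap (hf : ContDiff ℝ 2 f) : Continuous (lap f) := by
  have : lap f = fun x => ∑ i, pd i (pd i f) x := rfl
  rw [this]
  exact continuous_finsetSum _ fun i _ => continuous_pd (contDiff_one_pd hf i) i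

lemma pd_comm (hf : ContDiff ℝ 2 f) (i j : Fin d) (x : EuclideanSpace ℝ (Fin d)) :
    pd i (pd j f) x = pd j (pd i f) x := by
  have hs : IsSymmSndFDerivAt ℝ f x :=
    hf.contDiffAt.isSymmSndFDerivAt (by simp)
  have hd : DifferentiableAt ℝ (fderiv ℝ f) x :=
    ((hf.fderiv_right (m := 1) (by norm_num)).differentiable (by norm_num)) x
  have key : ∀ k l : Fin d, pd k (pd l f) x =
      fderiv ℝ (fderiv ℝ f) x (EuclideanSpace.single k 1) (EuclideanSpace.single l 1) := by
    intro k l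
    change fderiv ℝ (fun y => fderiv ℝ f y (EuclideanSpace.single l 1)) x _ = _
    rw [fderiv_clm_apply hd (differentiableAt_const _)]
    simp
  rw [key, key, hs]

lemma lap_mul (hf : ContDiff ℝ 2 f) (hg : ContDiff ℝ 2 g) (x : EuclideanSpace ℝ (Fin d)) :
    lap (fun y => f y * g y) x =
      lap f x * g x + 2 * ∑ i, pd i f x * pd i g x + f x * lap g x := by
  have hf1 : Differentiable ℝ f := hf.differentiable (by norm_num)
  have hg1 : Differentiable ℝ g := hg.differentiable (by norm_num)
  have hfi := fun i => (contDiff_one_pd hf i).differentiable one_ne_zero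
  have hgi := fun i => (contDiff_one_pd hg i).differentiable one_ne_zero
  simp only [lap_eq_sum_pd, Finset.sum_mul, Finset.mul_sum, ← Finset.sum_add_distrib]
  refine Finset.sum_congr rfl fun i _ => ?_
  have h1 : pd i (fun y => f y * g y) = fun y => pd i f y * g y + f y * pd i g y := by
    funext y; exact pd_mul (hf1 y) (hg1 y) i
  rw [h1, pd_add ((hfi i x).fun_mul (hg1 x)) ((hf1 x).fun_mul (hgi i x)), pd_mul (hfi i x) (hg1 x),
    pd_mul (hf1 x) (hgi i x)]
  ring

lemma pd_eq_zero_of_notMem_tsupport (hx : x ∉ tsupport f) (i : Fin d) : pd i f x = 0 := by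
  rw [pd_congr (notMem_tsupport_iff_eventuallyEq.mp hx) i]
  exact pd_zero i x

lemma lap_eq_zero_of_notMem_tsupport (hx : x ∉ tsupport f) : lap f x = 0 := by
  rw [lap_congr (notMem_tsupport_iff_eventuallyEq.mp hx), lap_eq_sum_pd]
  refine Finset.sum_eq_zero fun i _ => ?_
  have : pd i (0 : EuclideanSpace ℝ (Fin d) → ℝ) = fun _ => 0 := by
    funext y; exact pd_zero i y
  rw [this, pd_zero]

lemma integral_pd_eq_zero (hf : ContDiff ℝ 1 f) (hc : HasCompactSupport f) (i : Fin d) :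
    ∫ x, pd i f x = 0 := by
  have hpc : HasCompactSupport (pd i f) := by
    refine HasCompactSupport.of_support_subset_isCompact hc fun x hx => ?_
    by_contra h
    exact hx (pd_eq_zero_of_notMem_tsupport h i)
  have hI : Integrable (pd i f) volume :=
    (continuous_pd hf i).integrable_of_hasCompactSupport hpc
  have h := integral_mul_fderiv_eq_neg_fderiv_mul_of_integrable (μ := volume)
    (f := fun _ => (1 : ℝ)) (g := f) (v := EuclideanSpace.single i (1 : ℝ)) (by simp)
    (by simp only [one_mul]; exact hI)
    (by simpa using hf.continuous.integrable_of_hasCompactSupport hc)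
    (by simp) (fun x _ => hf.differentiable one_ne_zero x)
  simpa [pd] using h

end Calculus

section Divergence

variable {d : ℕ}

/-- The Rellich–Pohozaev type vector field
`a (x·∇f) ∇f - ½ a |∇f|² x + b f ∇f + c f² x`. -/
noncomputable def pohozaevField (a b c f : EuclideanSpace ℝ (Fin d) → ℝ) (i : Fin d)
    (y : EuclideanSpace ℝ (Fin d)) : ℝ :=
  a y * (∑ j, y j * pd j f y) * pd i f y - a y * (∑ j, pd j f y * pd j f y) * (1 / 2 * y i)
    + b y * f y * pd i f y + c y * (f y * f y) * y i

lemma pd_pohozaevField {a b c f : EuclideanSpace ℝ (Fin d) → ℝ} {x : EuclideanSpace ℝ (Fin d)}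
    (hf : ContDiff ℝ 2 f) (ha : DifferentiableAt ℝ a x) (hb : DifferentiableAt ℝ b x)
    (hc : DifferentiableAt ℝ c x) (i : Fin d) :
    pd i (pohozaevField a b c f i) x =
      (pd i a x * (∑ j, x j * pd j f x) + a x * (pd i f x + ∑ j, x j * pd i (pd j f) x))
          * pd i f x + a x * (∑ j, x j * pd j f x) * pd i (pd i f) x
        - ((pd i a x * (∑ j, pd j f x * pd j f x)
            + a x * (2 * ∑ j, pd j f x * pd i (pd j f) x)) * (1 / 2 * x i)
          + a x * (∑ j, pd j f x * pd j f x) * (1 / 2))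
        + ((pd i b x * f x + b x * pd i f x) * pd i f x + b x * f x * pd i (pd i f) x)
        + ((pd i c x * (f x * f x) + c x * (2 * f x * pd i f x)) * x i
          + c x * (f x * f x)) := by
  have hf0 : DifferentiableAt ℝ f x := hf.differentiable (by norm_num) x
  have hfi : ∀ j, DifferentiableAt ℝ (pd j f) x := fun j =>
    (contDiff_one_pd hf j).differentiable one_ne_zero x
  have hxi : ∀ j : Fin d, DifferentiableAt ℝ (fun y : EuclideanSpace ℝ (Fin d) => y j) x :=
    fun j => (EuclideanSpace.proj j : EuclideanSpace ℝ (Fin d) →L[ℝ] ℝ).differentiableAt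
  have hE : DifferentiableAt ℝ (fun y => ∑ j, y j * pd j f y) x :=
    DifferentiableAt.fun_sum fun j _ => (hxi j).fun_mul (hfi j)
  have hG : DifferentiableAt ℝ (fun y => ∑ j, pd j f y * pd j f y) x :=
    DifferentiableAt.fun_sum fun j _ => (hfi j).fun_mul (hfi j)
  have dE : pd i (fun y => ∑ j, y j * pd j f y) x = pd i f x + ∑ j, x j * pd i (pd j f) x := by
    rw [pd_sum fun j _ => (hxi j).fun_mul (hfi j)]
    simp_rw [fun j => pd_mul (hxi j) (hfi j) i, pd_coord, Finset.sum_add_distrib]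
    simp
  have dG : pd i (fun y => ∑ j, pd j f y * pd j f y) x
      = 2 * ∑ j, pd j f x * pd i (pd j f) x := by
    rw [pd_sum fun j _ => (hfi j).fun_mul (hfi j), Finset.mul_sum]
    refine Finset.sum_congr rfl fun j _ => ?_
    rw [pd_mul (hfi j) (hfi j)]
    ring
  have dhalf : pd i (fun y => 1 / 2 * y i) x = 1 / 2 := by
    rw [pd_mul (differentiableAt_const _) (hxi i), pd_coord]
    simp [pd]
  have hhalf : DifferentiableAt ℝ (fun y : EuclideanSpace ℝ (Fin d) => 1 / 2 * y i) x :=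
    (hxi i).const_mul _
  unfold pohozaevField
  rw [pd_add (by fun_prop) (by fun_prop), pd_add (by fun_prop) (by fun_prop),
    pd_sub (by fun_prop) (by fun_prop), pd_mul (ha.fun_mul hE) (hfi i), pd_mul ha hE,
    pd_mul (ha.fun_mul hG) hhalf, pd_mul ha hG,
    pd_mul (hb.fun_mul hf0) (hfi i), pd_mul hb hf0,
    pd_mul (hc.fun_mul (hf0.fun_mul hf0)) (hxi i), pd_mul hc (hf0.fun_mul hf0),
    pd_mul hf0 hf0, dE, dG, dhalf, pd_coord]
  simp only [if_true]
  ring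

lemma sum_pd_pohozaevField {a b c f : EuclideanSpace ℝ (Fin d) → ℝ}
    {x : EuclideanSpace ℝ (Fin d)} {a' b' c' : ℝ}
    (hf : ContDiff ℝ 2 f) (ha : DifferentiableAt ℝ a x) (hb : DifferentiableAt ℝ b x)
    (hc : DifferentiableAt ℝ c x) (ha' : ∀ i, pd i a x = 2 * a' * x i)
    (hb' : ∀ i, pd i b x = 2 * b' * x i) (hc' : ∀ i, pd i c x = 2 * c' * x i) :
    ∑ i, pd i (pohozaevField a b c f i) x =
      lap f x * (a x * (∑ j, x j * pd j f x) + b x * f x)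
        + 2 * a' * (∑ j, x j * pd j f x) ^ 2
        + ((1 - d / 2) * a x - ‖x‖ ^ 2 * a' + b x) * (∑ j, pd j f x * pd j f x)
        + (2 * b' + 2 * c x) * f x * (∑ j, x j * pd j f x)
        + (d * c x + 2 * ‖x‖ ^ 2 * c') * f x ^ 2 := by
  have hsymm : ∑ i, x i * ∑ j, pd j f x * pd i (pd j f) x
      = ∑ i, (∑ j, x j * pd i (pd j f) x) * pd i f x := by
    simp_rw [Finset.mul_sum, Finset.sum_mul]
    rw [Finset.sum_comm]
    refine Finset.sum_congr rfl fun i _ => Finset.sum_congr rfl fun j _ => ?_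
    rw [pd_comm hf j i]
    ring
  simp_rw [fun i => pd_pohozaevField hf ha hb hc i, ha', hb', hc']
  set E := ∑ j, x j * pd j f x with hE
  set G := ∑ j, pd j f x * pd j f x with hG
  have hs : ‖x‖ ^ 2 = ∑ i, x i * x i := by
    rw [EuclideanSpace.real_norm_sq_eq]
    exact Finset.sum_congr rfl fun i _ => by ring
  have key : ∀ i, ((2 * a' * x i * E + a x * (pd i f x + ∑ j, x j * pd i (pd j f) x))
          * pd i f x + a x * E * pd i (pd i f) x
        - ((2 * a' * x i * G
            + a x * (2 * ∑ j, pd j f x * pd i (pd j f) x)) * (1 / 2 * x i)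
          + a x * G * (1 / 2))
        + ((2 * b' * x i * f x + b x * pd i f x) * pd i f x + b x * f x * pd i (pd i f) x)
        + ((2 * c' * x i * (f x * f x) + c x * (2 * f x * pd i f x)) * x i
          + c x * (f x * f x))) =
      (2 * a' * E + 2 * b' * f x + 2 * c x * f x) * (x i * pd i f x)
      + (a x + b x) * (pd i f x * pd i f x)
      + (a x * E + b x * f x) * pd i (pd i f) x
      + (2 * c' * f x ^ 2 - a' * G) * (x i * x i)
      + a x * ((∑ j, x j * pd i (pd j f) x) * pd i f x)
      - a x * (x i * ∑ j, pd j f x * pd i (pd j f) x)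
      + (c x * f x ^ 2 - a x * G * (1 / 2)) := by
    intro i; ring
  simp_rw [key, Finset.sum_add_distrib, Finset.sum_sub_distrib, Finset.sum_add_distrib,
    ← Finset.mul_sum]
  rw [hsymm, ← hs, ← hE, ← hG, lap_eq_sum_pd]
  simp
  ring

end Divergence

section Carleman

/-- The radial Carleman weight `s^{-q} e^{βs}`, as a function of `s = |x|²`. -/
noncomputable def carlemanWeight (q β s : ℝ) : ℝ := s ^ (-q) * Real.exp (β * s)

lemma carlemanWeight_pos {q β s : ℝ} (hs : 0 < s) : 0 < carlemanWeight q β s :=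
  mul_pos (Real.rpow_pos_of_pos hs _) (Real.exp_pos _)

lemma carlemanWeight_nonneg {q β s : ℝ} (hs : 0 ≤ s) : 0 ≤ carlemanWeight q β s :=
  mul_nonneg (Real.rpow_nonneg hs _) (Real.exp_pos _).le

lemma hasDerivAt_carlemanWeight {q β s : ℝ} (hs : 0 < s) :
    HasDerivAt (carlemanWeight q β) ((β - q / s) * carlemanWeight q β s) s := by
  have h1 : HasDerivAt (fun t : ℝ => t ^ (-q)) (-q * s ^ (-q - 1)) s :=
    Real.hasDerivAt_rpow_const (Or.inl hs.ne')
  have h2 : HasDerivAt (fun t : ℝ => Real.exp (β * t)) (Real.exp (β * s) * (β * 1)) s :=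
    ((hasDerivAt_id s).const_mul β).exp
  refine (h1.mul h2).congr_deriv ?_
  rw [Real.rpow_sub_one hs.ne', carlemanWeight]
  ring

lemma contDiffAt_carlemanWeight {q β s : ℝ} (hs : 0 < s) {n : WithTop ℕ∞} :
    ContDiffAt ℝ n (carlemanWeight q β) s :=
  (Real.contDiffAt_rpow_const_of_ne hs.ne').mul
    (Real.contDiff_exp.contDiffAt.comp s (contDiffAt_const.mul contDiffAt_id))

lemma carleman_quadratic_form {d n p β s A E f L : ℝ} (hd : 1 ≤ d) (hp : p = d / 2 - 1)
    (hn : 2 ≤ n) (hs : 0 < s) (hA : 0 < A) (hβ : 0 ≤ β) (hβs : β * s ≤ n / 2) {D : ℝ}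
    (hD : D = L * (A * E + -(n - β * s) * A * f)
        + 2 * ((β - (n + p) / s) * A) * E ^ 2
        + (2 * (β * A + -(n - β * s) * ((β - (n + p) / s) * A))
          + 2 * (((n - β * s) ^ 2 + p * (n - β * s) - β * s) / s * A)) * f * E
        + (d * (((n - β * s) ^ 2 + p * (n - β * s) - β * s) / s * A)
          + 2 * s * (((-2 * β * (n - β * s) - p * β - β) * s
              - ((n - β * s) ^ 2 + p * (n - β * s) - β * s)) / s ^ 2 * A
            + ((n - β * s) ^ 2 + p * (n - β * s) - β * s) / s * ((β - (n + p) / s) * A)))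
          * f ^ 2) :
    2 * n ^ 2 * β * A * f ^ 2 ≤ s * A * L ^ 2 - 2 * n * D := by
  have hd' : d = 2 * p + 2 := by linarith
  have key : s * A * L ^ 2 - 2 * n * D =
      A / s * ((s * L - n * (E - (n - β * s) * f)) ^ 2
        + n * ((4 * (n - β * s) + 4 * p - n) * (E - (n - β * s) * f) ^ 2
          + 4 * β * s * (n - β * s + p + 1) * f ^ 2)) := by
    rw [hD, hd']
    field_simp
    ring
  rw [key]
  have h1 : 0 ≤ 4 * (n - β * s) + 4 * p - n := by linarith
  have h2 : n / 2 ≤ n - β * s + p + 1 := by linarith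
  have h3 : 4 * β * s * (n / 2) * f ^ 2 ≤ 4 * β * s * (n - β * s + p + 1) * f ^ 2 := by gcongr
  calc 2 * n ^ 2 * β * A * f ^ 2 = A / s * (n * (4 * β * s * (n / 2) * f ^ 2)) := by
        field_simp
        ring
    _ ≤ A / s * ((s * L - n * (E - (n - β * s) * f)) ^ 2
        + n * ((4 * (n - β * s) + 4 * p - n) * (E - (n - β * s) * f) ^ 2
          + 4 * β * s * (n - β * s + p + 1) * f ^ 2)) := by
      have h4 : 0 ≤ (4 * (n - β * s) + 4 * p - n) * (E - (n - β * s) * f) ^ 2 :=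
        mul_nonneg h1 (sq_nonneg _)
      have h5 := sq_nonneg (s * L - n * (E - (n - β * s) * f))
      have hn0 : (0:ℝ) ≤ n := by linarith
      gcongr
      nlinarith [mul_le_mul_of_nonneg_left (add_le_add h4 h3) hn0]

variable {d : ℕ}

lemma hasDerivAt_carlemanCoeff {n p β s : ℝ} (hs : 0 < s) :
    HasDerivAt (fun t => -(n - β * t) * carlemanWeight (n + p) β t)
      (β * carlemanWeight (n + p) β s
        + -(n - β * s) * ((β - (n + p) / s) * carlemanWeight (n + p) β s)) s := by
  have h1 : HasDerivAt (fun t : ℝ => -(n - β * t)) β s := by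
    simpa using (((hasDerivAt_id' s).const_mul β).const_sub n).fun_neg
  exact h1.mul (hasDerivAt_carlemanWeight hs)

lemma hasDerivAt_carlemanCoeff' {n p β s : ℝ} (hs : 0 < s) :
    HasDerivAt (fun t => ((n - β * t) ^ 2 + p * (n - β * t) - β * t) / t
        * carlemanWeight (n + p) β t)
      (((-2 * β * (n - β * s) - p * β - β) * s
          - ((n - β * s) ^ 2 + p * (n - β * s) - β * s)) / s ^ 2 * carlemanWeight (n + p) β s
        + ((n - β * s) ^ 2 + p * (n - β * s) - β * s) / s
          * ((β - (n + p) / s) * carlemanWeight (n + p) β s)) s := by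
  have h0 : HasDerivAt (fun t : ℝ => β * t) β s := by
    simpa using (hasDerivAt_id s).const_mul β
  have h1 : HasDerivAt (fun t : ℝ => n - β * t) (-β) s := h0.const_sub n
  have h2 := ((((h1.fun_pow 2).fun_add (h1.const_mul p)).fun_sub h0).fun_div (hasDerivAt_id' s)
    hs.ne').fun_mul
    (hasDerivAt_carlemanWeight (q := n + p) (β := β) hs)
  refine h2.congr_deriv ?_
  simp only [Nat.cast_ofNat]
  ring

/-- The vector field whose divergence gives the Carleman estimate. -/
noncomputable def carlemanField (n β : ℝ) (f : EuclideanSpace ℝ (Fin d) → ℝ) (i : Fin d) :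
    EuclideanSpace ℝ (Fin d) → ℝ :=
  pohozaevField (fun y => carlemanWeight (n + (d / 2 - 1)) β (‖y‖ ^ 2))
    (fun y => -(n - β * ‖y‖ ^ 2) * carlemanWeight (n + (d / 2 - 1)) β (‖y‖ ^ 2))
    (fun y => ((n - β * ‖y‖ ^ 2) ^ 2 + (d / 2 - 1) * (n - β * ‖y‖ ^ 2) - β * ‖y‖ ^ 2) / ‖y‖ ^ 2
        * carlemanWeight (n + (d / 2 - 1)) β (‖y‖ ^ 2)) f i

lemma carleman_pointwise {f : EuclideanSpace ℝ (Fin d) → ℝ} {x : EuclideanSpace ℝ (Fin d)}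
    (hd : 1 ≤ d) (hf : ContDiff ℝ 2 f) (hx : x ≠ 0) {n β : ℝ} (hn : 2 ≤ n) (hβ : 0 ≤ β)
    (hβx : β * ‖x‖ ^ 2 ≤ n / 2) :
    2 * n ^ 2 * β * carlemanWeight (n + (d / 2 - 1)) β (‖x‖ ^ 2) * f x ^ 2 ≤
      ‖x‖ ^ 2 * carlemanWeight (n + (d / 2 - 1)) β (‖x‖ ^ 2) * lap f x ^ 2
        - 2 * n * ∑ i, pd i (carlemanField n β f i) x := by
  have hs : 0 < ‖x‖ ^ 2 := by positivity
  have hd' : (1 : ℝ) ≤ d := by exact_mod_cast hd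
  have hsq : DifferentiableAt ℝ (fun y : EuclideanSpace ℝ (Fin d) => ‖y‖ ^ 2) x :=
    (hasStrictFDerivAt_norm_sq x).hasFDerivAt.differentiableAt
  have hA := hasDerivAt_carlemanWeight (q := n + (d / 2 - 1)) (β := β) hs
  have hB := hasDerivAt_carlemanCoeff (n := n) (p := d / 2 - 1) (β := β) hs
  have hC := hasDerivAt_carlemanCoeff' (n := n) (p := d / 2 - 1) (β := β) hs
  refine carleman_quadratic_form (E := ∑ j, x j * pd j f x) hd' rfl hn hs
    (carlemanWeight_pos hs) hβ hβx ?_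
  unfold carlemanField
  rw [sum_pd_pohozaevField hf (hA.differentiableAt.fun_comp' x hsq)
    (hB.differentiableAt.fun_comp' x hsq) (hC.differentiableAt.fun_comp' x hsq)
    (pd_radial hA) (pd_radial hB) (pd_radial hC)]
  field_simp
  ring

lemma contDiff_carlemanField {f : EuclideanSpace ℝ (Fin d) → ℝ} (hf : ContDiff ℝ 2 f)
    (h0 : (0 : EuclideanSpace ℝ (Fin d)) ∉ tsupport f) (n β : ℝ) (i : Fin d) :
    ContDiff ℝ 1 (carlemanField n β f i) := by
  rw [contDiff_iff_contDiffAt]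
  intro x
  by_cases hx : x = 0
  · have hz := notMem_tsupport_iff_eventuallyEq.mp (hx ▸ h0 : x ∉ tsupport f)
    have : carlemanField n β f i =ᶠ[nhds x] fun _ => 0 := by
      filter_upwards [hz, pd_eventuallyEq hz i,
        (Filter.eventually_all (ι := Fin d)).2 fun j => pd_eventuallyEq hz j]
        with y h1 _ h3
      have h4 : ∀ j, pd j f y = 0 := fun j => (h3 j).trans (pd_zero j y)
      simp [carlemanField, pohozaevField, h1, h4]
    exact contDiffAt_const.congr_of_eventuallyEq this
  · have hs : 0 < ‖x‖ ^ 2 := by positivity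
    have hsq : ContDiffAt ℝ 1 (fun y : EuclideanSpace ℝ (Fin d) => ‖y‖ ^ 2) x :=
      (contDiff_norm_sq ℝ).contDiffAt
    have hw : ContDiffAt ℝ 1 (fun y : EuclideanSpace ℝ (Fin d) =>
        carlemanWeight (n + (d / 2 - 1)) β (‖y‖ ^ 2)) x :=
      ContDiffAt.comp x (g := carlemanWeight (n + (d / 2 - 1)) β) (contDiffAt_carlemanWeight hs) hsq
    have hf1 : ContDiffAt ℝ 1 f x := (hf.of_le (by norm_num)).contDiffAt
    have hpd : ∀ j, ContDiffAt ℝ 1 (pd j f) x := fun j => (contDiff_one_pd hf j).contDiffAt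
    have hxi : ∀ j : Fin d, ContDiffAt ℝ 1 (fun y : EuclideanSpace ℝ (Fin d) => y j) x :=
      fun j => (EuclideanSpace.proj j : EuclideanSpace ℝ (Fin d) →L[ℝ] ℝ).contDiff.contDiffAt
    have hν : ContDiffAt ℝ 1 (fun y : EuclideanSpace ℝ (Fin d) => n - β * ‖y‖ ^ 2) x :=
      contDiffAt_const.sub (contDiffAt_const.mul hsq)
    have hE : ContDiffAt ℝ 1 (fun y => ∑ j, y j * pd j f y) x :=
      ContDiffAt.sum fun j _ => (hxi j).mul (hpd j)
    have hG : ContDiffAt ℝ 1 (fun y => ∑ j, pd j f y * pd j f y) x :=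
      ContDiffAt.sum fun j _ => (hpd j).mul (hpd j)
    exact ((((hw.mul hE).mul (hpd i)).sub ((hw.mul hG).mul (contDiffAt_const.mul (hxi i)))).add
      (((hν.neg.mul hw).mul hf1).mul (hpd i))).add
      ((((((hν.pow 2).add (contDiffAt_const.mul hν)).sub (contDiffAt_const.mul hsq)).div hsq
        hs.ne').mul hw).mul (hf1.mul hf1) |>.mul (hxi i))

lemma support_carlemanField_subset (f : EuclideanSpace ℝ (Fin d) → ℝ) (n β : ℝ) (i : Fin d) :
    Function.support (carlemanField n β f i) ⊆ tsupport f := by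
  intro y hy
  by_contra h
  refine hy ?_
  have h4 : ∀ j, pd j f y = 0 := fun j => pd_eq_zero_of_notMem_tsupport h j
  simp [carlemanField, pohozaevField, h4, image_eq_zero_of_notMem_tsupport h]

lemma integrable_carlemanWeight_mul_sq {f : EuclideanSpace ℝ (Fin d) → ℝ} (hf : Continuous f)
    (hc : HasCompactSupport f) (h0 : (0 : EuclideanSpace ℝ (Fin d)) ∉ tsupport f) (q β : ℝ) :
    Integrable (fun x => carlemanWeight q β (‖x‖ ^ 2) * f x ^ 2) := by
  refine Continuous.integrable_of_hasCompactSupport ?_ ?_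
  · rw [continuous_iff_continuousAt]
    intro x
    by_cases hx : x = 0
    · have hz := notMem_tsupport_iff_eventuallyEq.mp (hx ▸ h0 : x ∉ tsupport f)
      have : (fun x => carlemanWeight q β (‖x‖ ^ 2) * f x ^ 2) =ᶠ[nhds x] fun _ => 0 := by
        filter_upwards [hz] with y h1
        simp [h1]
      exact continuousAt_const.congr this.symm
    · have hs : 0 < ‖x‖ ^ 2 := by positivity
      have hw : ContinuousAt (fun y : EuclideanSpace ℝ (Fin d) =>
          carlemanWeight q β (‖y‖ ^ 2)) x :=
        ContinuousAt.comp (g := carlemanWeight q β)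
          (contDiffAt_carlemanWeight (n := 1) hs).continuousAt (by fun_prop)
      exact hw.mul (hf.continuousAt.pow 2)
  · refine HasCompactSupport.of_support_subset_isCompact hc fun y hy => ?_
    by_contra h
    exact hy (by simp [image_eq_zero_of_notMem_tsupport h])

/-- Carleman estimate with weight `|x|^{-2q} e^{β|x|²}`, `q = n + d/2 - 1`; the right-hand side
may contain a part of the left-hand side. -/
lemma carleman_estimate {f : EuclideanSpace ℝ (Fin d) → ℝ} (hd : 1 ≤ d) (hf : ContDiff ℝ 2 f)
    (hc : HasCompactSupport f) (h0 : (0 : EuclideanSpace ℝ (Fin d)) ∉ tsupport f) {n β : ℝ}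
    (hn : 2 ≤ n) (hβ : 0 ≤ β) (hβx : ∀ x ∈ tsupport f, β * ‖x‖ ^ 2 ≤ n / 2)
    {g : EuclideanSpace ℝ (Fin d) → ℝ} (hg : Integrable g)
    (hfg : ∀ x, ‖x‖ ^ 2 * carlemanWeight (n + (d / 2 - 1)) β (‖x‖ ^ 2) * lap f x ^ 2 ≤
      n ^ 2 * β * (carlemanWeight (n + (d / 2 - 1)) β (‖x‖ ^ 2) * f x ^ 2) + g x) :
    n ^ 2 * β * ∫ x, carlemanWeight (n + (d / 2 - 1)) β (‖x‖ ^ 2) * f x ^ 2 ≤ ∫ x, g x := by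
  have hI := integrable_carlemanWeight_mul_sq hf.continuous hc h0 (n + (d / 2 - 1)) β
  have hF := fun i => contDiff_carlemanField hf h0 n β i
  have hFc : ∀ i, HasCompactSupport (carlemanField n β f i) := fun i =>
    HasCompactSupport.of_support_subset_isCompact hc (support_carlemanField_subset f n β i)
  have hpI : ∀ i, Integrable (pd i (carlemanField n β f i)) := fun i =>
    (continuous_pd (hF i) i).integrable_of_hasCompactSupport <|
      HasCompactSupport.of_support_subset_isCompact (hFc i) fun y hy => by
        by_contra h
        exact hy (pd_eq_zero_of_notMem_tsupport h i)
  have hsum : Integrable fun x => ∑ i, pd i (carlemanField n β f i) x :=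
    integrable_finsetSum _ fun i _ => hpI i
  have hz : ∫ x, ∑ i, pd i (carlemanField n β f i) x = 0 := by
    rw [integral_finsetSum _ fun i _ => hpI i]
    exact Finset.sum_eq_zero fun i _ => integral_pd_eq_zero (hF i) (hFc i) i
  calc n ^ 2 * β * ∫ x, carlemanWeight (n + (d / 2 - 1)) β (‖x‖ ^ 2) * f x ^ 2
      = ∫ x, n ^ 2 * β * (carlemanWeight (n + (d / 2 - 1)) β (‖x‖ ^ 2) * f x ^ 2) :=
        (integral_const_mul _ _).symm
    _ ≤ ∫ x, (g x - 2 * n * ∑ i, pd i (carlemanField n β f i) x) := by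
        refine integral_mono (hI.const_mul _) (hg.sub (hsum.const_mul _)) fun x => ?_
        by_cases hx : x ∈ tsupport f
        · have hx0 : x ≠ 0 := fun h => h0 (h ▸ hx)
          have h1 := carleman_pointwise hd hf hx0 hn hβ (hβx x hx)
          have h2 := hfg x
          simp only
          linarith
        · have h1 : ∀ i, pd i (carlemanField n β f i) x = 0 := fun i =>
            pd_eq_zero_of_notMem_tsupport
              (fun h => hx (closure_minimal (support_carlemanField_subset f n β i)
                (isClosed_tsupport f) h)) i
          have h2 := hfg x
          simp only [lap_eq_zero_of_notMem_tsupport hx, image_eq_zero_of_notMem_tsupport hx] at h2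
          simp only [image_eq_zero_of_notMem_tsupport hx, h1]
          simpa using h2
    _ = ∫ x, g x := by
        rw [integral_sub hg (hsum.const_mul _), integral_const_mul, hz]
        simp

end Carleman

section Cutoff

variable {d : ℕ}

lemma lap_comp_smul {f : EuclideanSpace ℝ (Fin d) → ℝ} (hf : ContDiff ℝ 2 f) (r : ℝ)
    (x : EuclideanSpace ℝ (Fin d)) : lap (fun y => f (r • y)) x = r ^ 2 * lap f (r • x) := by
  simp only [lap_eq_sum_pd, Finset.mul_sum]
  refine Finset.sum_congr rfl fun i _ => ?_
  have h1 : pd i (fun y => f (r • y)) = fun y => r * pd i f (r • y) := by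
    funext y; exact pd_comp_smul (hf.differentiable (by norm_num)) r i y
  have h2 : Differentiable ℝ (pd i f) := (contDiff_one_pd hf i).differentiable one_ne_zero
  have h3 : Differentiable ℝ fun y => pd i f (r • y) := h2.comp (differentiable_id.const_smul r)
  rw [h1, pd_mul (differentiableAt_const r) (h3 x), pd_comp_smul h2]
  simp only [pd, fderiv_fun_const]
  simp
  ring

/-- Cutoff functions between the ball of radius `ρ` and that of radius `2ρ`, with derivatives
bounded uniformly in the scale `ρ`. -/
lemma exists_cutoff (d : ℕ) : ∃ C : ℝ, 1 ≤ C ∧ ∀ ρ : ℝ, 0 < ρ →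
    ∃ χ : EuclideanSpace ℝ (Fin d) → ℝ, ContDiff ℝ 2 χ ∧ (∀ x, 0 ≤ χ x) ∧ (∀ x, χ x ≤ 1) ∧
      (∀ x, ‖x‖ ≤ ρ → χ x = 1) ∧ HasCompactSupport χ ∧ tsupport χ ⊆ Metric.ball 0 (2 * ρ) ∧
      (∀ x, ∑ i, pd i χ x ^ 2 ≤ C / ρ ^ 2) ∧ ∀ x, |lap χ x| ≤ C / ρ ^ 2 := by
  let B : ContDiffBump (0 : EuclideanSpace ℝ (Fin d)) := ⟨1, 3 / 2, by norm_num, by norm_num⟩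
  have hB : ContDiff ℝ 2 B := B.contDiff
  have hBc : HasCompactSupport B := B.hasCompactSupport
  have hpc : HasCompactSupport fun x => ∑ i, pd i B x ^ 2 :=
    HasCompactSupport.of_support_subset_isCompact hBc fun y hy => by
      by_contra h
      exact hy (by simp [pd_eq_zero_of_notMem_tsupport h])
  have hlc : HasCompactSupport (lap B) :=
    HasCompactSupport.of_support_subset_isCompact hBc fun y hy => by
      by_contra h
      exact hy (lap_eq_zero_of_notMem_tsupport h)
  have hpcont : Continuous fun x => ∑ i, pd i B x ^ 2 :=
    continuous_finsetSum _ fun i _ => (continuous_pd (hB.of_le (by norm_num)) i).pow 2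
  obtain ⟨C1, hC1⟩ := hpcont.bounded_above_of_compact_support hpc
  obtain ⟨C2, hC2⟩ := (continuous_lap hB).bounded_above_of_compact_support hlc
  refine ⟨max 1 (max C1 C2), le_max_left _ _,
    fun ρ hρ => ⟨fun x => B (ρ⁻¹ • x), ?_, ?_, ?_, ?_, ?_⟩⟩
  · exact hB.comp (contDiff_const_smul _)
  · exact fun x => B.nonneg
  · exact fun x => B.le_one
  · intro x hx
    refine B.one_of_mem_closedBall ?_
    rw [mem_closedBall_zero_iff, norm_smul, norm_inv, Real.norm_of_nonneg hρ.le]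
    exact (inv_mul_le_one₀ hρ).2 hx
  · have hsub : tsupport (fun x => B (ρ⁻¹ • x)) ⊆ Metric.closedBall 0 (3 / 2 * ρ) := by
      intro x hx
      have h1 := tsupport_comp_subset_preimage B (continuous_const_smul ρ⁻¹) hx
      rw [Set.mem_preimage, B.tsupport_eq, mem_closedBall_zero_iff, norm_smul, norm_inv,
        Real.norm_of_nonneg hρ.le] at h1
      have h2 : ρ⁻¹ * ‖x‖ ≤ 3 / 2 := h1
      rw [inv_mul_le_iff₀ hρ] at h2
      rw [mem_closedBall_zero_iff]
      linarith
    refine ⟨(isCompact_closedBall _ _).of_isClosed_subset (isClosed_tsupport _) hsub,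
      hsub.trans (Metric.closedBall_subset_ball (by linarith)), fun x => ?_, fun x => ?_⟩
    · simp_rw [fun i => pd_comp_smul (hB.differentiable (by norm_num)) ρ⁻¹ i x, mul_pow,
        ← Finset.mul_sum]
      rw [inv_pow, div_eq_inv_mul]
      gcongr
      exact ((le_abs_self _).trans (hC1 _)).trans ((le_max_left _ _).trans (le_max_right _ _))
    · rw [lap_comp_smul hB, abs_mul, abs_of_nonneg (by positivity), inv_pow, div_eq_inv_mul]
      gcongr
      exact (hC2 _).trans ((le_max_right _ _).trans (le_max_right _ _))

lemma abs_mul_lap_le {u L K Z ρ : ℝ} (hρ : 0 < ρ) (h : |L| ≤ K * |u| + |Z|) :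
    |u * L| ≤ (1 / 2 / ρ ^ 2 + K) * u ^ 2 + 1 / 2 * (ρ ^ 2 * Z ^ 2) := by
  rw [abs_mul]
  have h1 : |u| * |L| ≤ |u| * (K * |u| + |Z|) := by gcongr
  have h2 := sq_nonneg (|u| / ρ - ρ * |Z|)
  have h3 : (|u| / ρ - ρ * |Z|) ^ 2 = u ^ 2 / ρ ^ 2 + ρ ^ 2 * Z ^ 2 - 2 * (|u| * |Z|) := by
    rw [← sq_abs u, ← sq_abs Z]
    field_simp
    ring
  have h4 : |u| * |u| = u ^ 2 := by rw [← sq, sq_abs]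
  have h5 : |u| * (K * |u| + |Z|) = K * u ^ 2 + |u| * |Z| := by rw [← h4]; ring
  have h6 : (1 / 2 / ρ ^ 2 + K) * u ^ 2 = 1 / 2 * (u ^ 2 / ρ ^ 2) + K * u ^ 2 := by ring
  rw [h6]
  linarith

/-- Caccioppoli inequality. -/
lemma caccioppoli {C ρ : ℝ} (hC : 1 ≤ C) (hρ : 0 < ρ) {χ : EuclideanSpace ℝ (Fin d) → ℝ}
    (hχ : ContDiff ℝ 2 χ) (hχ0 : ∀ x, 0 ≤ χ x) (hχ1 : ∀ x, χ x ≤ 1)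
    (hχρ : ∀ x, ‖x‖ ≤ ρ → χ x = 1) (hχc : HasCompactSupport χ)
    (hχs : tsupport χ ⊆ Metric.ball 0 (2 * ρ)) (hχl : ∀ x, |lap χ x| ≤ C / ρ ^ 2)
    {u Z : EuclideanSpace ℝ (Fin d) → ℝ} (hu : ContDiff ℝ 2 u) {K : ℝ}
    (hZ : IntegrableOn (fun x => Z x ^ 2) (Metric.ball 0 (2 * ρ)))
    (huZ : ∀ x ∈ Metric.ball 0 (2 * ρ), |lap u x| ≤ K * |u x| + |Z x|) :
    ∫ x in Metric.closedBall 0 ρ, ∑ i, pd i u x ^ 2 ≤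
      (C / ρ ^ 2 + K) * (∫ x in Metric.ball 0 (2 * ρ), u x ^ 2)
        + ρ ^ 2 * ∫ x in Metric.ball 0 (2 * ρ), Z x ^ 2 := by
  set F : Fin d → EuclideanSpace ℝ (Fin d) → ℝ := fun i y =>
    χ y * u y * pd i u y - (1 / 2 * (u y * u y)) * pd i χ y with hF
  have hu1 : ContDiff ℝ 1 u := hu.of_le (by norm_num)
  have hχ1' : ContDiff ℝ 1 χ := hχ.of_le (by norm_num)
  have hui := fun i => contDiff_one_pd hu i
  have hχi := fun i => contDiff_one_pd hχ i
  have hFd : ∀ i, ContDiff ℝ 1 (F i) := fun i =>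
    ((hχ1'.mul hu1).mul (hui i)).sub ((contDiff_const.mul (hu1.mul hu1)).mul (hχi i))
  have hFs : ∀ i, Function.support (F i) ⊆ tsupport χ := fun i y hy => by
    by_contra h
    exact hy (by simp [hF, pd_eq_zero_of_notMem_tsupport h, image_eq_zero_of_notMem_tsupport h])
  have hFc : ∀ i, HasCompactSupport (F i) := fun i =>
    HasCompactSupport.of_support_subset_isCompact hχc (hFs i)
  have hpI : ∀ i, Integrable (pd i (F i)) := fun i =>
    (continuous_pd (hFd i) i).integrable_of_hasCompactSupport <|
      HasCompactSupport.of_support_subset_isCompact (hFc i) fun y hy => by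
        by_contra h
        exact hy (pd_eq_zero_of_notMem_tsupport h i)
  have hsum : Integrable fun x => ∑ i, pd i (F i) x := integrable_finsetSum _ fun i _ => hpI i
  have hz : ∫ x, ∑ i, pd i (F i) x = 0 := by
    rw [integral_finsetSum _ fun i _ => hpI i]
    exact Finset.sum_eq_zero fun i _ => integral_pd_eq_zero (hFd i) (hFc i) i
  have hdiv : ∀ x, ∑ i, pd i (F i) x =
      χ x * (∑ i, pd i u x ^ 2) + χ x * (u x * lap u x) - 1 / 2 * u x ^ 2 * lap χ x := by
    intro x
    have du := hu1.differentiable one_ne_zero x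
    have dχ := hχ1'.differentiable one_ne_zero x
    have dui := fun i => (hui i).differentiable one_ne_zero x
    have dχi := fun i => (hχi i).differentiable one_ne_zero x
    simp only [lap_eq_sum_pd, Finset.mul_sum, ← Finset.sum_add_distrib, ← Finset.sum_sub_distrib]
    refine Finset.sum_congr rfl fun i _ => ?_
    rw [hF, pd_sub (by fun_prop) (by fun_prop), pd_mul (dχ.fun_mul du) (dui i), pd_mul dχ du,
      pd_mul ((du.fun_mul du).const_mul _) (dχi i),
      pd_mul (differentiableAt_const _) (du.fun_mul du),
      pd_mul du du]
    simp only [pd, fderiv_fun_const]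
    simp
    ring
  set H : EuclideanSpace ℝ (Fin d) → ℝ := fun x => (C / ρ ^ 2 + K) * u x ^ 2 + ρ ^ 2 * Z x ^ 2
  have hub : IntegrableOn (fun x => u x ^ 2) (Metric.ball 0 (2 * ρ)) :=
    ((hu.continuous.pow 2).continuousOn.integrableOn_compact
      (isCompact_closedBall 0 (2 * ρ))).mono_set Metric.ball_subset_closedBall
  have hH : IntegrableOn H (Metric.ball 0 (2 * ρ)) := (hub.const_mul _).add (hZ.const_mul _)
  have hG : IntegrableOn (fun x => ∑ i, pd i u x ^ 2) (Metric.closedBall 0 ρ) :=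
    (continuous_finsetSum _ fun i _ =>
      (continuous_pd hu1 i).pow 2).continuousOn.integrableOn_compact
      (isCompact_closedBall 0 ρ)
  calc ∫ x in Metric.closedBall 0 ρ, ∑ i, pd i u x ^ 2
      = ∫ x, (Metric.closedBall 0 ρ).indicator (fun x => ∑ i, pd i u x ^ 2) x :=
        (integral_indicator Metric.isClosed_closedBall.measurableSet).symm
    _ ≤ ∫ x, (∑ i, pd i (F i) x + (Metric.ball 0 (2 * ρ)).indicator H x) := by
        refine integral_mono (hG.integrable_indicator Metric.isClosed_closedBall.measurableSet)
          (hsum.add (hH.integrable_indicator Metric.isOpen_ball.measurableSet)) fun x => ?_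
        have hle : (Metric.closedBall 0 ρ).indicator (fun x => ∑ i, pd i u x ^ 2) x
            ≤ χ x * ∑ i, pd i u x ^ 2 := by
          have h0 : 0 ≤ ∑ i, pd i u x ^ 2 := Finset.sum_nonneg fun i _ => sq_nonneg _
          by_cases hx : x ∈ Metric.closedBall 0 ρ
          · rw [Set.indicator_of_mem hx, hχρ x (mem_closedBall_zero_iff.1 hx), one_mul]
          · rw [Set.indicator_of_notMem hx]
            exact mul_nonneg (hχ0 x) h0
        refine hle.trans ?_
        simp only [hdiv]
        by_cases hx : x ∈ Metric.ball 0 (2 * ρ)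
        · rw [Set.indicator_of_mem hx]
          have h1 := abs_mul_lap_le hρ (huZ x hx)
          have h2 : -(χ x * (u x * lap u x)) ≤ |u x * lap u x| := by
            calc -(χ x * (u x * lap u x)) ≤ |χ x * (u x * lap u x)| := neg_le_abs _
              _ = χ x * |u x * lap u x| := by rw [abs_mul, abs_of_nonneg (hχ0 x)]
              _ ≤ 1 * |u x * lap u x| := by gcongr; exact hχ1 x
              _ = _ := one_mul _
          have h3 : 1 / 2 * u x ^ 2 * lap χ x ≤ 1 / 2 * u x ^ 2 * (C / ρ ^ 2) := by
            gcongr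
            exact (le_abs_self _).trans (hχl x)
          have h4 : 1 / 2 / ρ ^ 2 * u x ^ 2 ≤ C / 2 / ρ ^ 2 * u x ^ 2 := by gcongr
          have h5 : 0 ≤ ρ ^ 2 * Z x ^ 2 := by positivity
          have h6 : 1 / 2 * u x ^ 2 * (C / ρ ^ 2) + C / 2 / ρ ^ 2 * u x ^ 2 =
              C / ρ ^ 2 * u x ^ 2 := by
            ring
          simp only [H]
          linarith
        · have hx' : x ∉ tsupport χ := fun h => hx (hχs h)
          rw [Set.indicator_of_notMem hx, lap_eq_zero_of_notMem_tsupport hx',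
            image_eq_zero_of_notMem_tsupport hx']
          simp
    _ = ∫ x in Metric.ball 0 (2 * ρ), H x := by
        rw [integral_add hsum (hH.integrable_indicator Metric.isOpen_ball.measurableSet), hz,
          zero_add, integral_indicator Metric.isOpen_ball.measurableSet]
    _ = _ := by
        rw [integral_add (hub.const_mul _) (hZ.const_mul _), integral_const_mul, integral_const_mul]

lemma carlemanWeight_antitoneOn {q β S : ℝ} (hβ : 0 ≤ β) (hS : β * S ≤ q) :
    AntitoneOn (carlemanWeight q β) (Set.Ioc 0 S) := by
  refine antitoneOn_of_deriv_nonpos (convex_Ioc 0 S) ?_ ?_ ?_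
  · exact fun s hs => (hasDerivAt_carlemanWeight hs.1).continuousAt.continuousWithinAt
  · rw [interior_Ioc]
    exact fun s hs => (hasDerivAt_carlemanWeight hs.1).differentiableAt.differentiableWithinAt
  · rw [interior_Ioc]
    intro s hs
    rw [(hasDerivAt_carlemanWeight hs.1).deriv]
    refine mul_nonpos_of_nonpos_of_nonneg ?_ (carlemanWeight_pos hs.1).le
    rw [sub_nonpos, le_div_iff₀ hs.1]
    exact (mul_le_mul_of_nonneg_left hs.2.le hβ).trans hS

lemma mul_carlemanWeight {q β s : ℝ} (hs : 0 < s) :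
    s * carlemanWeight q β s = carlemanWeight (q - 1) β s := by
  have : s ^ (-(q - 1)) = s * s ^ (-q) := by
    rw [show -(q - 1) = 1 + -q by ring, Real.rpow_add hs, Real.rpow_one]
  rw [carlemanWeight, carlemanWeight, this]
  ring

end Cutoff

section CutoffEstimate

variable {d : ℕ}

lemma lap_mul_sq_le {η u : EuclideanSpace ℝ (Fin d) → ℝ} {x : EuclideanSpace ℝ (Fin d)}
    (hη : ContDiff ℝ 2 η) (hu : ContDiff ℝ 2 u) {K z P : ℝ}
    (hp : ∑ i, pd i η x ^ 2 ≤ P) (hl : |lap η x| ≤ P) (hz : |lap u x| ≤ K * |u x| + |z|) :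
    lap (fun y => η y * u y) x ^ 2 ≤ 4 * K ^ 2 * (η x * u x) ^ 2 + 4 * (η x * z) ^ 2
      + (16 * P * (∑ i, pd i u x ^ 2) + 4 * P ^ 2 * u x ^ 2) := by
  rw [lap_mul hη hu]
  have hcs : (∑ i, pd i η x * pd i u x) ^ 2 ≤ P * ∑ i, pd i u x ^ 2 :=
    (Finset.sum_mul_sq_le_sq_mul_sq _ _ _).trans
      (mul_le_mul_of_nonneg_right hp (Finset.sum_nonneg fun i _ => sq_nonneg _))
  have hr : (lap η x * u x) ^ 2 ≤ P ^ 2 * u x ^ 2 := by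
    rw [mul_pow]
    exact mul_le_mul_of_nonneg_right (sq_le_sq' (by linarith [(abs_le.1 hl).1]) (abs_le.1 hl).2)
      (sq_nonneg _)
  have ht : (η x * lap u x) ^ 2 ≤ 2 * K ^ 2 * (η x * u x) ^ 2 + 2 * (η x * z) ^ 2 := by
    have h1 : (lap u x) ^ 2 ≤ (K * |u x| + |z|) ^ 2 := by
      rw [← sq_abs]
      gcongr
    have h2 : (K * |u x| + |z|) ^ 2 ≤ 2 * K ^ 2 * u x ^ 2 + 2 * z ^ 2 := by
      rw [← sq_abs (u x), ← sq_abs z]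
      nlinarith [sq_nonneg (K * |u x| - |z|)]
    calc (η x * lap u x) ^ 2 = η x ^ 2 * lap u x ^ 2 := by ring
      _ ≤ η x ^ 2 * (2 * K ^ 2 * u x ^ 2 + 2 * z ^ 2) := by gcongr; exact h1.trans h2
      _ = _ := by ring
  set g := ∑ i, pd i η x * pd i u x
  set t := η x * lap u x
  set r := lap η x * u x
  nlinarith [sq_nonneg (r + 2 * g - t), sq_nonneg (r - 2 * g)]

lemma pd_neg (f : EuclideanSpace ℝ (Fin d) → ℝ) (i : Fin d) (x : EuclideanSpace ℝ (Fin d)) :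
    pd i (fun y => -f y) x = -pd i f x := by
  simp only [pd, fderiv_fun_neg]
  simp

lemma pd_const_sub (c : ℝ) (f : EuclideanSpace ℝ (Fin d) → ℝ) (i : Fin d)
    (x : EuclideanSpace ℝ (Fin d)) : pd i (fun y => c - f y) x = -pd i f x := by
  simp only [pd, fderiv_const_sub]
  simp

lemma lap_const_sub (c : ℝ) (f : EuclideanSpace ℝ (Fin d) → ℝ) (x : EuclideanSpace ℝ (Fin d)) :
    lap (fun y => c - f y) x = -lap f x := by
  rw [lap_eq_sum_pd, lap_eq_sum_pd, ← Finset.sum_neg_distrib]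
  refine Finset.sum_congr rfl fun i _ => ?_
  rw [show pd i (fun y => c - f y) = fun y => -pd i f y from funext fun y => pd_const_sub c f i y,
    pd_neg]

/-- The error terms produced by a cutoff at scale `ρ` are controlled by `u` on a larger ball. -/
lemma integral_cutoff_error_le {C ρ K : ℝ} (hC : 1 ≤ C) (hρ : 0 < ρ) (hK : 0 ≤ K)
    {χ : EuclideanSpace ℝ (Fin d) → ℝ}
    (hχ : ContDiff ℝ 2 χ) (hχ0 : ∀ x, 0 ≤ χ x) (hχ1 : ∀ x, χ x ≤ 1)
    (hχρ : ∀ x, ‖x‖ ≤ 2 * ρ → χ x = 1) (hχc : HasCompactSupport χ)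
    (hχs : tsupport χ ⊆ Metric.ball 0 (4 * ρ)) (hχl : ∀ x, |lap χ x| ≤ C / (2 * ρ) ^ 2)
    {u Z : EuclideanSpace ℝ (Fin d) → ℝ} (hu : ContDiff ℝ 2 u)
    (hZ : IntegrableOn (fun x => Z x ^ 2) (Metric.ball 0 (4 * ρ)))
    (huZ : ∀ x ∈ Metric.ball 0 (4 * ρ), |lap u x| ≤ K * |u x| + |Z x|) :
    ∫ x in Metric.closedBall (0 : EuclideanSpace ℝ (Fin d)) (2 * ρ),
        (16 * (C / ρ ^ 2) * (∑ i, pd i u x ^ 2) + 4 * (C / ρ ^ 2) ^ 2 * u x ^ 2) ≤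
      20 * C ^ 2 * (1 / ρ ^ 2 * (1 / ρ ^ 2 + K)) *
        (∫ x in Metric.ball (0 : EuclideanSpace ℝ (Fin d)) (4 * ρ), u x ^ 2) +
        64 * C * ∫ x in Metric.ball (0 : EuclideanSpace ℝ (Fin d)) (4 * ρ), Z x ^ 2 := by
  have hgradI : IntegrableOn (fun x => ∑ i, pd i u x ^ 2)
      (Metric.closedBall (0 : EuclideanSpace ℝ (Fin d)) (2 * ρ)) :=
    (continuous_finsetSum _ fun i _ =>
      (continuous_pd (hu.of_le (by norm_num)) i).pow 2).continuousOn.integrableOn_compact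
      (isCompact_closedBall 0 _)
  have husqI : ∀ ρ, IntegrableOn (fun x => u x ^ 2)
      (Metric.closedBall (0 : EuclideanSpace ℝ (Fin d)) ρ) := fun ρ =>
    (hu.continuous.pow 2).continuousOn.integrableOn_compact (isCompact_closedBall 0 ρ)
  have hρ4 : 2 * (2 * ρ) = 4 * ρ := by ring
  have hca := caccioppoli hC (by positivity) hχ hχ0 hχ1 hχρ hχc (by rwa [hρ4]) hχl hu
    (by rwa [hρ4]) (by rwa [hρ4])
  rw [hρ4] at hca
  have hule : ∫ x in Metric.closedBall (0 : EuclideanSpace ℝ (Fin d)) (2 * ρ), u x ^ 2 ≤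
      ∫ x in Metric.ball (0 : EuclideanSpace ℝ (Fin d)) (4 * ρ), u x ^ 2 :=
    setIntegral_mono_set ((husqI _).mono_set Metric.ball_subset_closedBall)
      (Filter.Eventually.of_forall fun x => sq_nonneg _)
      (Metric.closedBall_subset_ball (by linarith)).eventuallyLE
  have hU0 : 0 ≤ ∫ x in Metric.ball (0 : EuclideanSpace ℝ (Fin d)) (4 * ρ), u x ^ 2 :=
    integral_nonneg fun x => sq_nonneg _
  rw [integral_add (hgradI.const_mul _) ((husqI _).const_mul _), integral_const_mul,
    integral_const_mul]
  generalize (∫ x in Metric.ball (0 : EuclideanSpace ℝ (Fin d)) (4 * ρ), u x ^ 2) = U at *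
  generalize (∫ x in Metric.ball (0 : EuclideanSpace ℝ (Fin d)) (4 * ρ), Z x ^ 2) = ZZ at *
  have h9 : C ≤ C ^ 2 := by nlinarith
  have h10 : C * (1 / ρ ^ 2 * K) ≤ C ^ 2 * (1 / ρ ^ 2 * K) := by gcongr
  have h11 : 0 ≤ C ^ 2 * (1 / ρ ^ 2 * (1 / ρ ^ 2)) := by positivity
  have h12 : 0 ≤ C * (1 / ρ ^ 2 * K) := by positivity
  have h13 : 8 * C ^ 2 * (1 / ρ ^ 2 * (1 / ρ ^ 2)) + 16 * C * (1 / ρ ^ 2 * K) ≤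
      20 * C ^ 2 * (1 / ρ ^ 2 * (1 / ρ ^ 2 + K)) := by linarith
  calc _ ≤ 16 * (C / ρ ^ 2) * ((C / (2 * ρ) ^ 2 + K) * U + (2 * ρ) ^ 2 * ZZ)
        + 4 * (C / ρ ^ 2) ^ 2 * U :=
        add_le_add (mul_le_mul_of_nonneg_left hca (by positivity))
          (mul_le_mul_of_nonneg_left hule (by positivity))
    _ = (8 * C ^ 2 * (1 / ρ ^ 2 * (1 / ρ ^ 2)) + 16 * C * (1 / ρ ^ 2 * K)) * U
        + 64 * C * ZZ := by
        field_simp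
        ring
    _ ≤ _ := add_le_add_left (mul_le_mul_of_nonneg_right h13 hU0) _

set_option maxHeartbeats 1000000 in
lemma carleman_cutoff_estimate (hd : 1 ≤ d) : ∃ C : ℝ, 1 ≤ C ∧
    ∀ u : EuclideanSpace ℝ (Fin d) → ℝ, ContDiff ℝ 2 u →
    ∀ (Z : EuclideanSpace ℝ (Fin d) → ℝ) (K : ℝ), 0 ≤ K → ∀ Q : ℝ, 1 ≤ Q →
      (∀ x ∈ Metric.ball 0 (6 * Q), |lap u x| ≤ K * |u x| + |Z x|) →
      IntegrableOn (fun x => Z x ^ 2) (Metric.ball 0 (6 * Q)) →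
    ∀ r : ℝ, 0 < r → 4 * r ≤ 1 → ∀ n : ℝ, 3 ≤ n → 648 * Q ^ 4 * K ^ 2 ≤ n ^ 3 →
    ∀ Θ : Set (EuclideanSpace ℝ (Fin d)), MeasurableSet Θ → Θ ⊆ Metric.closedBall 0 Q →
      (∀ x ∈ Θ, 4 * r ≤ ‖x‖) →
    ∀ A : ℝ → ℝ, A = carlemanWeight (n + (d / 2 - 1)) (n / (18 * Q ^ 2)) →
      n ^ 3 / (18 * Q ^ 2) * (A (Q ^ 2) * ∫ x in Θ, u x ^ 2) ≤
        C * (A (r ^ 2) * ((1 + K) / r ^ 2 * (∫ x in Metric.ball 0 (4 * r), u x ^ 2)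
            + r ^ 2 * ∫ x in Metric.ball 0 (6 * Q), Z x ^ 2)
          + A ((3 / 2 * Q) ^ 2) * ((1 + K) * ∫ x in Metric.ball 0 (6 * Q), u x ^ 2)) := by
  obtain ⟨C, hC, hcut⟩ := exists_cutoff d
  refine ⟨132 * C ^ 2, by nlinarith, ?_⟩
  intro u hu Z K hK Q hQ huZ hZ r hr hr1 n hn hnK Θ hΘm hΘQ hΘr A hA
  set R := 3 / 2 * Q with hR
  have hR0 : 0 < R := by positivity
  have hR6 : 6 * Q = 4 * R := by rw [hR]; ring
  rw [hR6] at huZ hZ ⊢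
  set q : ℝ := n + (d / 2 - 1) with hq
  set β : ℝ := n / (18 * Q ^ 2) with hβ
  have hβ0 : 0 ≤ β := by positivity
  have hd' : (1 : ℝ) ≤ d := by exact_mod_cast hd
  have hβR : β * (2 * R) ^ 2 = n / 2 := by
    rw [hβ, hR]; field_simp; ring
  obtain ⟨χ₁, h1C, h10, h11, h1r, h1c, h1s, h1p, h1l⟩ := hcut r hr
  obtain ⟨χ₂, h2C, h20, h21, h2r, h2c, h2s, h2p, h2l⟩ := hcut R hR0
  set η : EuclideanSpace ℝ (Fin d) → ℝ := fun y => χ₂ y * (1 - χ₁ y) with hη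
  have hηC : ContDiff ℝ 2 η := h2C.mul (contDiff_const.sub h1C)
  set f : EuclideanSpace ℝ (Fin d) → ℝ := fun y => η y * u y with hf
  have hfC : ContDiff ℝ 2 f := hηC.mul hu
  have hfs : tsupport f ⊆ Metric.ball 0 (2 * R) :=
    ((tsupport_mul_subset_left (f := η) (g := u)).trans
      (tsupport_mul_subset_left (f := χ₂) (g := fun y => 1 - χ₁ y))).trans h2s
  have hfc : HasCompactSupport f := (h2c.mul_right (f' := fun y => 1 - χ₁ y)).mul_right
  have hf0 : ∀ x ∈ Metric.ball (0 : EuclideanSpace ℝ (Fin d)) r, x ∉ tsupport f := by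
    intro x hx
    rw [notMem_tsupport_iff_eventuallyEq]
    filter_upwards [Metric.isOpen_ball.mem_nhds hx] with y hy
    simp [hf, hη, h1r y (mem_ball_zero_iff.1 hy).le]
  have h0 : (0 : EuclideanSpace ℝ (Fin d)) ∉ tsupport f := hf0 0 (Metric.mem_ball_self hr)
  have hfβ : ∀ x ∈ tsupport f, β * ‖x‖ ^ 2 ≤ n / 2 := fun x hx => by
    rw [← hβR]
    have := (mem_ball_zero_iff.1 (hfs hx)).le
    gcongr
  have hη0 : ∀ x, 0 ≤ η x := fun x => mul_nonneg (h20 x) (sub_nonneg.2 (h11 x))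
  have hη1 : ∀ x, η x ≤ 1 := fun x =>
    mul_le_one₀ (h21 x) (sub_nonneg.2 (h11 x)) (sub_le_self _ (h10 x))
  have hW : AntitoneOn (carlemanWeight (q - 1) β) (Set.Ioc 0 ((2 * R) ^ 2)) :=
    carlemanWeight_antitoneOn hβ0 (by rw [hβR, hq]; linarith)
  have hWA : ∀ s, 0 < s → carlemanWeight (q - 1) β s = s * A s := fun s hs => by
    rw [hA, mul_carlemanWeight hs]
  set w₁ := r ^ 2 * A (r ^ 2) with hw₁
  set w₂ := R ^ 2 * A (R ^ 2) with hw₂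
  have hrR : 4 * r ≤ R := by rw [hR]; linarith
  have hApos : ∀ s, 0 < s → 0 < A s := fun s hs => by rw [hA]; exact carlemanWeight_pos hs
  have hw₁0 : 0 ≤ w₁ := mul_nonneg (sq_nonneg _) (hApos _ (by positivity)).le
  have hw₂0 : 0 ≤ w₂ := mul_nonneg (sq_nonneg _) (hApos _ (by positivity)).le
  have hw : ∀ t x, 0 < t → t ≤ x → x ≤ 2 * R → x ^ 2 * A (x ^ 2) ≤ t ^ 2 * A (t ^ 2) := by
    intro t x ht htx hx
    have hx0 : 0 < x := ht.trans_le htx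
    rw [← hWA _ (by positivity), ← hWA _ (by positivity)]
    refine hW ⟨by positivity, ?_⟩ ⟨by positivity, ?_⟩ ?_
    · have := htx.trans hx
      gcongr
    · gcongr
    · gcongr
  have hw₂₁ : w₂ ≤ w₁ := hw r R hr (by linarith) (by linarith)
  set B₁ := Metric.closedBall (0 : EuclideanSpace ℝ (Fin d)) (2 * r) with hB₁
  set B₂ := Metric.closedBall (0 : EuclideanSpace ℝ (Fin d)) (2 * R) with hB₂
  set G : ℝ → EuclideanSpace ℝ (Fin d) → ℝ := fun ρ x =>
    16 * (C / ρ ^ 2) * (∑ i, pd i u x ^ 2) + 4 * (C / ρ ^ 2) ^ 2 * u x ^ 2 with hG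
  have hG0 : ∀ ρ x, 0 ≤ G ρ x := fun ρ x =>
    add_nonneg (mul_nonneg (by positivity) (Finset.sum_nonneg fun i _ => sq_nonneg _))
      (by positivity)
  set g : EuclideanSpace ℝ (Fin d) → ℝ := fun x =>
    4 * w₁ * (Metric.ball (0 : EuclideanSpace ℝ (Fin d)) (4 * R)).indicator (fun x => Z x ^ 2) x
      + (w₁ * B₁.indicator (G r) x + w₂ * B₂.indicator (G R) x) with hg
  have hfg : ∀ x, ‖x‖ ^ 2 * A (‖x‖ ^ 2) * lap f x ^ 2 ≤
      n ^ 2 * β * (A (‖x‖ ^ 2) * f x ^ 2) + g x := by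
    intro x
    have hi1 : 0 ≤ B₁.indicator (G r) x := Set.indicator_nonneg (fun x _ => hG0 r x) x
    have hi2 : 0 ≤ B₂.indicator (G R) x := Set.indicator_nonneg (fun x _ => hG0 R x) x
    have hiZ : 0 ≤ (Metric.ball (0 : EuclideanSpace ℝ (Fin d)) (4 * R)).indicator
        (fun x => Z x ^ 2) x := Set.indicator_nonneg (fun x _ => sq_nonneg _) x
    by_cases hx : x ∈ tsupport f
    · have hxr : r ≤ ‖x‖ := by
        by_contra! h
        exact hf0 x (mem_ball_zero_iff.2 h) hx
      have hxR : ‖x‖ < 2 * R := mem_ball_zero_iff.1 (hfs hx)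
      have hx0 : 0 < ‖x‖ := hr.trans_le hxr
      have hxb : x ∈ Metric.ball (0 : EuclideanSpace ℝ (Fin d)) (4 * R) :=
        mem_ball_zero_iff.2 (by linarith)
      have hAx : 0 < A (‖x‖ ^ 2) := hApos _ (by positivity)
      have hwx : ‖x‖ ^ 2 * A (‖x‖ ^ 2) ≤ w₁ := hw r ‖x‖ hr hxr hxR.le
      have hmain : ∀ P, (∑ i, pd i η x ^ 2 ≤ P) → |lap η x| ≤ P →
          ‖x‖ ^ 2 * A (‖x‖ ^ 2) * (16 * P * (∑ i, pd i u x ^ 2) + 4 * P ^ 2 * u x ^ 2) ≤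
            w₁ * B₁.indicator (G r) x + w₂ * B₂.indicator (G R) x →
          ‖x‖ ^ 2 * A (‖x‖ ^ 2) * lap f x ^ 2 ≤ n ^ 2 * β * (A (‖x‖ ^ 2) * f x ^ 2) + g x := by
        intro P hP hl hPw
        have h1 := lap_mul_sq_le hηC hu hP hl (huZ x hxb)
        have h2 : ‖x‖ ^ 2 * A (‖x‖ ^ 2) * (4 * K ^ 2 * f x ^ 2) ≤
            n ^ 2 * β * (A (‖x‖ ^ 2) * f x ^ 2) := by
          have h3 : ‖x‖ ^ 2 * (4 * K ^ 2) ≤ n ^ 2 * β := by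
            calc ‖x‖ ^ 2 * (4 * K ^ 2) ≤ (2 * R) ^ 2 * (4 * K ^ 2) := by gcongr
              _ = 648 * Q ^ 4 * K ^ 2 / (18 * Q ^ 2) := by rw [hR]; field_simp; ring
              _ ≤ n ^ 3 / (18 * Q ^ 2) := by gcongr
              _ = n ^ 2 * β := by rw [hβ]; ring
          calc ‖x‖ ^ 2 * A (‖x‖ ^ 2) * (4 * K ^ 2 * f x ^ 2)
              = ‖x‖ ^ 2 * (4 * K ^ 2) * (A (‖x‖ ^ 2) * f x ^ 2) := by ring
            _ ≤ _ := by gcongr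
        have h4 : ‖x‖ ^ 2 * A (‖x‖ ^ 2) * (4 * (η x * Z x) ^ 2) ≤ 4 * w₁ * Z x ^ 2 := by
          have h5 : (η x * Z x) ^ 2 ≤ Z x ^ 2 := by
            rw [mul_pow]
            exact mul_le_of_le_one_left (sq_nonneg _) (pow_le_one₀ (hη0 x) (hη1 x))
          calc ‖x‖ ^ 2 * A (‖x‖ ^ 2) * (4 * (η x * Z x) ^ 2) ≤ w₁ * (4 * Z x ^ 2) := by gcongr
            _ = _ := by ring
        have h6 := mul_le_mul_of_nonneg_left h1 (mul_nonneg (sq_nonneg ‖x‖) hAx.le)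
        simp only [hg, Set.indicator_of_mem hxb]
        simp only [hf] at h2 ⊢
        linarith
      rcases lt_or_ge ‖x‖ R with hxR' | hxR'
      · have heq : η =ᶠ[nhds x] fun y => 1 - χ₁ y := by
          filter_upwards [Metric.isOpen_ball.mem_nhds (mem_ball_zero_iff.2 hxR')] with y hy
          simp [hη, h2r y (mem_ball_zero_iff.1 hy).le]
        have hpd : ∀ i, pd i η x = -pd i χ₁ x := fun i => by
          rw [pd_congr heq, pd_const_sub]
        have hlap : lap η x = -lap χ₁ x := by
          rw [lap_congr heq, lap_const_sub]
        by_cases hx2 : x ∈ B₁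
        · refine hmain (C / r ^ 2) (by simpa [hpd] using h1p x) (by simpa [hlap] using h1l x) ?_
          rw [Set.indicator_of_mem hx2]
          have h7 : ‖x‖ ^ 2 * A (‖x‖ ^ 2) * G r x ≤ w₁ * G r x :=
            mul_le_mul_of_nonneg_right hwx (hG0 r x)
          exact h7.trans (le_add_of_nonneg_right (mul_nonneg hw₂0 hi2))
        · have hx3 : x ∉ tsupport χ₁ := fun h => hx2 (Metric.ball_subset_closedBall (h1s h))
          refine hmain 0 (by simp [hpd, pd_eq_zero_of_notMem_tsupport hx3])
            (by simp [hlap, lap_eq_zero_of_notMem_tsupport hx3]) ?_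
          simp only [mul_zero, zero_mul, ne_eq, OfNat.ofNat_ne_zero, not_false_eq_true, zero_pow,
            add_zero]
          positivity
      · have hx3 : x ∉ tsupport χ₁ := fun h => by
          have := mem_ball_zero_iff.1 (h1s h)
          linarith
        have heq : η =ᶠ[nhds x] χ₂ := by
          filter_upwards [notMem_tsupport_iff_eventuallyEq.mp hx3] with y hy
          simp [hη, hy]
        have hx2 : x ∈ B₂ := mem_closedBall_zero_iff.2 hxR.le
        refine hmain (C / R ^ 2) (by simpa [pd_congr heq] using h2p x)
          (by simpa [lap_congr heq] using h2l x) ?_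
        rw [Set.indicator_of_mem hx2]
        have h7 : ‖x‖ ^ 2 * A (‖x‖ ^ 2) * G R x ≤ w₂ * G R x :=
          mul_le_mul_of_nonneg_right (hw R ‖x‖ hR0 hxR' hxR.le) (hG0 R x)
        exact h7.trans (le_add_of_nonneg_left (mul_nonneg hw₁0 hi1))
    · simp only [lap_eq_zero_of_notMem_tsupport hx, image_eq_zero_of_notMem_tsupport hx]
      simp only [ne_eq, OfNat.ofNat_ne_zero, not_false_eq_true, zero_pow, mul_zero, zero_add, hg]
      positivity
  have hu1 : ContDiff ℝ 1 u := hu.of_le (by norm_num)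
  have hgradI : ∀ ρ, IntegrableOn (fun x => ∑ i, pd i u x ^ 2)
      (Metric.closedBall (0 : EuclideanSpace ℝ (Fin d)) ρ) := fun ρ =>
    (continuous_finsetSum _ fun i _ =>
      (continuous_pd hu1 i).pow 2).continuousOn.integrableOn_compact
      (isCompact_closedBall 0 ρ)
  have husqI : ∀ ρ, IntegrableOn (fun x => u x ^ 2)
      (Metric.closedBall (0 : EuclideanSpace ℝ (Fin d)) ρ) := fun ρ =>
    (hu.continuous.pow 2).continuousOn.integrableOn_compact (isCompact_closedBall 0 ρ)
  have hGI : ∀ ρ ρ', IntegrableOn (G ρ) (Metric.closedBall (0 : EuclideanSpace ℝ (Fin d)) ρ') :=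
    fun ρ ρ' => ((hgradI ρ').const_mul _).add ((husqI ρ').const_mul _)
  have hZi : Integrable ((Metric.ball (0 : EuclideanSpace ℝ (Fin d)) (4 * R)).indicator
      (fun x => Z x ^ 2)) := hZ.integrable_indicator Metric.isOpen_ball.measurableSet
  have hB₁i : Integrable (B₁.indicator (G r)) :=
    (hGI r _).integrable_indicator Metric.isClosed_closedBall.measurableSet
  have hB₂i : Integrable (B₂.indicator (G R)) :=
    (hGI R _).integrable_indicator Metric.isClosed_closedBall.measurableSet
  have hgI : Integrable g :=
    (hZi.const_mul _).add ((hB₁i.const_mul _).add (hB₂i.const_mul _))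
  set U := ∫ x in Metric.ball (0 : EuclideanSpace ℝ (Fin d)) (4 * R), u x ^ 2 with hU
  set Uδ := ∫ x in Metric.ball (0 : EuclideanSpace ℝ (Fin d)) (4 * r), u x ^ 2 with hUδ
  set ZZ := ∫ x in Metric.ball (0 : EuclideanSpace ℝ (Fin d)) (4 * R), Z x ^ 2 with hZZ
  have hU0 : 0 ≤ U := integral_nonneg fun x => sq_nonneg _
  have hUδ0 : 0 ≤ Uδ := integral_nonneg fun x => sq_nonneg _
  have hZZ0 : 0 ≤ ZZ := integral_nonneg fun x => sq_nonneg _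
  have hGint : ∀ ρ, 0 < ρ → ρ ≤ R → ∫ x in Metric.closedBall (0 : EuclideanSpace ℝ (Fin d)) (2 * ρ),
      G ρ x ≤ 20 * C ^ 2 * (1 / ρ ^ 2 * (1 / ρ ^ 2 + K)) *
        (∫ x in Metric.ball (0 : EuclideanSpace ℝ (Fin d)) (4 * ρ), u x ^ 2) + 64 * C * ZZ := by
    intro ρ hρ hρR
    obtain ⟨χ, hχ, hχ0, hχ1, hχρ, hχc, hχs, -, hχl⟩ := hcut (2 * ρ) (by positivity)
    have hsub : Metric.ball (0 : EuclideanSpace ℝ (Fin d)) (4 * ρ) ⊆ Metric.ball 0 (4 * R) :=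
      Metric.ball_subset_ball (by linarith)
    rw [show 2 * (2 * ρ) = 4 * ρ by ring] at hχs
    refine (integral_cutoff_error_le hC hρ hK hχ hχ0 hχ1 hχρ hχc hχs hχl hu (hZ.mono_set hsub)
      fun x hx => huZ x (hsub hx)).trans ?_
    have hZle : ∫ x in Metric.ball (0 : EuclideanSpace ℝ (Fin d)) (4 * ρ), Z x ^ 2 ≤ ZZ :=
      setIntegral_mono_set hZ (Filter.Eventually.of_forall fun x => sq_nonneg _) hsub.eventuallyLE
    gcongr
  have hgint : ∫ x, g x ≤ 132 * C ^ 2 *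
      (w₁ * (1 / r ^ 2 * (1 / r ^ 2 + K) * Uδ + ZZ) + w₂ * (1 / R ^ 2 * (1 / R ^ 2 + K)) * U) := by
    have hBi : Integrable fun x => w₁ * B₁.indicator (G r) x + w₂ * B₂.indicator (G R) x :=
      (hB₁i.const_mul _).add (hB₂i.const_mul _)
    simp only [hg]
    rw [integral_add (hZi.const_mul _) hBi,
      integral_add (hB₁i.const_mul _) (hB₂i.const_mul _), integral_const_mul, integral_const_mul,
      integral_const_mul, integral_indicator Metric.isOpen_ball.measurableSet,
      integral_indicator Metric.isClosed_closedBall.measurableSet,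
      integral_indicator Metric.isClosed_closedBall.measurableSet]
    have h1 := mul_le_mul_of_nonneg_left (hGint r hr (by linarith)) hw₁0
    have h2 := mul_le_mul_of_nonneg_left (hGint R hR0 le_rfl) hw₂0
    have h3 : w₂ * (64 * C * ZZ) ≤ w₁ * (64 * C * ZZ) := by gcongr
    have h4 : (4 + 128 * C) * (w₁ * ZZ) ≤ 132 * C ^ 2 * (w₁ * ZZ) := by
      gcongr
      nlinarith
    have h5 : 20 * C ^ 2 * (w₁ * (1 / r ^ 2 * (1 / r ^ 2 + K) * Uδ)) ≤
        132 * C ^ 2 * (w₁ * (1 / r ^ 2 * (1 / r ^ 2 + K) * Uδ)) := by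
      gcongr
      norm_num
    have h6 : 20 * C ^ 2 * (w₂ * (1 / R ^ 2 * (1 / R ^ 2 + K)) * U) ≤
        132 * C ^ 2 * (w₂ * (1 / R ^ 2 * (1 / R ^ 2 + K)) * U) := by
      gcongr
      norm_num
    linarith
  have hcarl := carleman_estimate hd hfC hfc h0 (by linarith) hβ0 hfβ hgI (by rwa [hA] at hfg)
  rw [← hA] at hcarl
  have hΘle : A (Q ^ 2) * ∫ x in Θ, u x ^ 2 ≤ ∫ x, A (‖x‖ ^ 2) * f x ^ 2 := by
    have hI : Integrable fun x => A (‖x‖ ^ 2) * f x ^ 2 := by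
      rw [hA]
      exact integrable_carlemanWeight_mul_sq hfC.continuous hfc h0 q β
    have hAanti : AntitoneOn A (Set.Ioc 0 ((2 * R) ^ 2)) := by
      rw [hA]
      exact carlemanWeight_antitoneOn hβ0 (by rw [hβR, hq]; linarith)
    calc A (Q ^ 2) * ∫ x in Θ, u x ^ 2 = ∫ x in Θ, A (Q ^ 2) * u x ^ 2 :=
          (integral_const_mul _ _).symm
      _ ≤ ∫ x in Θ, A (‖x‖ ^ 2) * f x ^ 2 := by
          refine setIntegral_mono_on (((husqI Q).mono_set hΘQ).const_mul _) hI.integrableOn hΘm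
            fun x hx => ?_
          have hxQ := mem_closedBall_zero_iff.1 (hΘQ hx)
          have hxr := hΘr x hx
          have hx3 : x ∉ tsupport χ₁ := fun h => by
            have := mem_ball_zero_iff.1 (h1s h)
            linarith
          have hfx : f x = u x := by
            simp [hf, hη, image_eq_zero_of_notMem_tsupport hx3, h2r x (by rw [hR]; linarith)]
          rw [hfx]
          have hx0 : 0 < ‖x‖ := by linarith
          have hQR : Q ≤ 2 * R := by rw [hR]; linarith
          refine mul_le_mul_of_nonneg_right (hAanti ⟨by positivity, ?_⟩ ⟨by positivity, ?_⟩ ?_)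
            (sq_nonneg _)
          · gcongr
            exact hxQ.trans hQR
          · gcongr
          · gcongr
      _ ≤ ∫ x, A (‖x‖ ^ 2) * f x ^ 2 :=
          setIntegral_le_integral hI (Filter.Eventually.of_forall fun x => by
            rw [hA]
            exact mul_nonneg (carlemanWeight_nonneg (sq_nonneg _)) (sq_nonneg _))
  have hAr := hApos (r ^ 2) (by positivity)
  have hAR := hApos (R ^ 2) (by positivity)
  calc n ^ 3 / (18 * Q ^ 2) * (A (Q ^ 2) * ∫ x in Θ, u x ^ 2)
      = n ^ 2 * β * (A (Q ^ 2) * ∫ x in Θ, u x ^ 2) := by rw [hβ]; ring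
    _ ≤ n ^ 2 * β * ∫ x, A (‖x‖ ^ 2) * f x ^ 2 := by gcongr
    _ ≤ _ := hcarl.trans hgint
    _ = 132 * C ^ 2 * (A (r ^ 2) * ((1 / r ^ 2 + K) * Uδ + r ^ 2 * ZZ)
          + A (R ^ 2) * ((1 / R ^ 2 + K) * U)) := by
        rw [hw₁, hw₂]
        field_simp
    _ ≤ _ := by
        have h1 : 1 / r ^ 2 + K ≤ (1 + K) / r ^ 2 := by
          rw [add_div]
          have : K ≤ K / r ^ 2 := by
            rw [le_div_iff₀ (by positivity)]
            exact mul_le_of_le_one_right hK (pow_le_one₀ hr.le (by linarith))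
          linarith
        have h2 : 1 / R ^ 2 ≤ 1 := by
          rw [div_le_one (by positivity)]
          exact one_le_pow₀ (by rw [hR]; linarith)
        gcongr

end CutoffEstimate

section Scaling

lemma cube_le_of_rpow_le {M K Q n : ℝ} (hM : 0 ≤ M) (hK : 0 ≤ K) (hQ : 0 ≤ Q)
    (h : M * (1 + K ^ ((2 : ℝ) / 3)) * Q ^ ((4 : ℝ) / 3) ≤ n) :
    M ^ 3 * (1 + K ^ 2) * Q ^ 4 ≤ n ^ 3 := by
  have hk0 : 0 ≤ K ^ ((2 : ℝ) / 3) := Real.rpow_nonneg hK _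
  have hq0 : 0 ≤ Q ^ ((4 : ℝ) / 3) := Real.rpow_nonneg hQ _
  have hk : (K ^ ((2 : ℝ) / 3)) ^ 3 = K ^ 2 := by
    rw [← Real.rpow_natCast, ← Real.rpow_mul hK, ← Real.rpow_natCast]
    norm_num
  have hq : (Q ^ ((4 : ℝ) / 3)) ^ 3 = Q ^ 4 := by
    rw [← Real.rpow_natCast, ← Real.rpow_mul hQ, ← Real.rpow_natCast]
    norm_num
  rw [← hk, ← hq]
  generalize K ^ ((2 : ℝ) / 3) = k at *
  generalize Q ^ ((4 : ℝ) / 3) = p at *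
  calc M ^ 3 * (1 + k ^ 3) * p ^ 3 ≤ M ^ 3 * (1 + k) ^ 3 * p ^ 3 := by
        gcongr
        nlinarith [sq_nonneg k]
    _ = (M * (1 + k) * p) ^ 3 := by ring
    _ ≤ n ^ 3 := by gcongr

lemma carlemanWeight_three_halves_le {n q β Q : ℝ} (hn : 3 ≤ n) (hq : n - 1 / 2 ≤ q) (hQ : 0 < Q)
    (hβ : β * Q ^ 2 = n / 18) :
    carlemanWeight q β ((3 / 2 * Q) ^ 2) ≤ Real.exp (-(n / 2)) * carlemanWeight q β (Q ^ 2) := by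
  have h1 : Real.exp (3 / 4) ≤ 9 / 4 := by
    refine le_of_pow_le_pow_left₀ (n := 4) (by norm_num) (by norm_num) ?_
    rw [← Real.exp_nat_mul]
    have h2 : Real.exp 1 ≤ 2.7182818286 := Real.exp_one_lt_d9.le
    calc Real.exp ((4 : ℕ) * (3 / 4)) = Real.exp 1 ^ 3 := by
          rw [← Real.exp_nat_mul]; norm_num
      _ ≤ 2.7182818286 ^ 3 := by gcongr
      _ ≤ _ := by norm_num
  have h3 : ((9 : ℝ) / 4) ^ (-q) ≤ Real.exp (-(3 / 4 * q)) := by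
    rw [Real.rpow_neg (by norm_num), Real.exp_neg]
    refine inv_anti₀ (Real.exp_pos _) ?_
    rw [Real.exp_mul]
    exact Real.rpow_le_rpow (Real.exp_pos _).le h1 (by linarith)
  have h4 : (3 / 2 * Q) ^ 2 = 9 / 4 * Q ^ 2 := by ring
  rw [carlemanWeight, carlemanWeight, h4, Real.mul_rpow (by norm_num) (by positivity)]
  calc (9 / 4) ^ (-q) * (Q ^ 2) ^ (-q) * Real.exp (β * (9 / 4 * Q ^ 2))
      ≤ Real.exp (-(3 / 4 * q)) * (Q ^ 2) ^ (-q) * Real.exp (β * (9 / 4 * Q ^ 2)) := by gcongr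
    _ = (Q ^ 2) ^ (-q) * Real.exp (-(3 / 4 * q) + β * (9 / 4 * Q ^ 2)) := by
        rw [Real.exp_add]; ring
    _ ≤ (Q ^ 2) ^ (-q) * Real.exp (-(n / 2) + β * Q ^ 2) := by
        refine mul_le_mul_of_nonneg_left (Real.exp_le_exp.2 ?_) (by positivity)
        linarith
    _ = _ := by rw [Real.exp_add]; ring

lemma rpow_mul_carlemanWeight_le {q β r Q : ℝ} (hβ : 0 ≤ β) (hr : 0 < r) (hrQ : r ≤ Q) :
    (r / Q) ^ (2 * q) * carlemanWeight q β (r ^ 2) ≤ carlemanWeight q β (Q ^ 2) := by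
  have hQ : 0 < Q := hr.trans_le hrQ
  have h1 : ∀ {t : ℝ}, 0 < t → (t ^ 2) ^ (-q) = (t ^ (2 * q))⁻¹ := fun {t} ht => by
    rw [← Real.rpow_natCast, ← Real.rpow_mul ht.le, ← Real.rpow_neg ht.le]
    norm_num
  rw [carlemanWeight, carlemanWeight, h1 hr, h1 hQ, Real.div_rpow hr.le hQ.le]
  have h2 : 0 < r ^ (2 * q) := Real.rpow_pos_of_pos hr _
  calc r ^ (2 * q) / Q ^ (2 * q) * ((r ^ (2 * q))⁻¹ * Real.exp (β * r ^ 2))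
      = (Q ^ (2 * q))⁻¹ * Real.exp (β * r ^ 2) := by field_simp
    _ ≤ _ := by gcongr

end Scaling

section UniqueContinuation

variable {d : ℕ}

lemma unique_continuation_at_zero (hd : 1 ≤ d) : ∃ M : ℝ, 0 < M ∧
    ∀ u : EuclideanSpace ℝ (Fin d) → ℝ, ContDiff ℝ 2 u →
    ∀ (Z : EuclideanSpace ℝ (Fin d) → ℝ) (K : ℝ), 0 ≤ K → ∀ Q : ℝ, 1 ≤ Q →
      (∀ x ∈ Metric.ball 0 (6 * Q), |lap u x| ≤ K * |u x| + |Z x|) →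
      IntegrableOn (fun x => Z x ^ 2) (Metric.ball 0 (6 * Q)) →
    ∀ r : ℝ, 0 < r → 4 * r ≤ 1 →
    ∀ n : ℝ, M * (1 + K ^ ((2 : ℝ) / 3)) * Q ^ ((4 : ℝ) / 3) ≤ n →
    ∀ Θ : Set (EuclideanSpace ℝ (Fin d)), MeasurableSet Θ → Θ ⊆ Metric.closedBall 0 Q →
      (∀ x ∈ Θ, 4 * r ≤ ‖x‖) →
      Real.exp (-(n / 2)) * (∫ x in Metric.ball 0 (6 * Q), u x ^ 2) ≤ ∫ x in Θ, u x ^ 2 →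
      (r / Q) ^ (2 * n + d) * (∫ x in Θ, u x ^ 2) ≤
        (∫ x in Metric.ball 0 (4 * r), u x ^ 2) +
          r ^ 2 * ∫ x in Metric.ball 0 (6 * Q), Z x ^ 2 := by
  obtain ⟨C, hC, hest⟩ := carleman_cutoff_estimate hd
  refine ⟨72 * C, by positivity, ?_⟩
  intro u hu Z K hK Q hQ huZ hZ r hr hr1 n hn Θ hΘm hΘQ hΘr hUΘ
  have hcube := cube_le_of_rpow_le (by positivity) hK (by positivity) hn
  have hC2 : 1 ≤ C ^ 2 := one_le_pow₀ hC
  have hC3 : C ≤ C ^ 3 := le_self_pow₀ hC (by norm_num)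
  have hQ4 : Q ^ 2 ≤ Q ^ 4 := pow_le_pow_right₀ hQ (by norm_num)
  have hn3 : 3 ≤ n := by
    have h1 : 1 ≤ Q ^ ((4 : ℝ) / 3) := Real.one_le_rpow hQ (by norm_num)
    have h2 : 0 ≤ K ^ ((2 : ℝ) / 3) := Real.rpow_nonneg hK _
    refine le_trans ?_ hn
    calc (3 : ℝ) ≤ 72 * 1 * (1 + 0) * 1 := by norm_num
      _ ≤ 72 * C * (1 + K ^ ((2 : ℝ) / 3)) * Q ^ ((4 : ℝ) / 3) := by gcongr
  have hnK : 648 * Q ^ 4 * K ^ 2 ≤ n ^ 3 := by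
    refine le_trans ?_ hcube
    calc 648 * Q ^ 4 * K ^ 2 = 648 * K ^ 2 * Q ^ 4 := by ring
      _ ≤ (72 * C) ^ 3 * (1 + K ^ 2) * Q ^ 4 := by
        gcongr
        · nlinarith
        · linarith
  have hnC : 36 * C * Q ^ 2 * (1 + K) ≤ n ^ 3 := by
    refine le_trans ?_ hcube
    calc 36 * C * Q ^ 2 * (1 + K) ≤ 36 * C ^ 3 * Q ^ 4 * (2 * (1 + K ^ 2)) := by
          gcongr
          nlinarith [sq_nonneg (K - 1)]
      _ = 72 * (C ^ 3 * (1 + K ^ 2) * Q ^ 4) := by ring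
      _ ≤ 72 ^ 3 * (C ^ 3 * (1 + K ^ 2) * Q ^ 4) := by gcongr; norm_num
      _ = _ := by ring
  have hd' : (1 : ℝ) ≤ d := by exact_mod_cast hd
  set β : ℝ := n / (18 * Q ^ 2) with hβ
  have hβ0 : 0 ≤ β := by positivity
  set q : ℝ := n + (d / 2 - 1) with hq
  set A := carlemanWeight q β with hA
  have h1 := hest u hu Z K hK Q hQ huZ hZ r hr hr1 n hn3 hnK Θ hΘm hΘQ hΘr A rfl
  have hA32 : A ((3 / 2 * Q) ^ 2) ≤ Real.exp (-(n / 2)) * A (Q ^ 2) :=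
    carlemanWeight_three_halves_le hn3 (by rw [hq]; linarith) (by positivity)
      (by rw [hβ]; field_simp)
  have hAr : (r / Q) ^ (2 * q) * A (r ^ 2) ≤ A (Q ^ 2) :=
    rpow_mul_carlemanWeight_le hβ0 hr (by linarith)
  have hAr0 : 0 < A (r ^ 2) := carlemanWeight_pos (by positivity)
  have hAQ0 : 0 < A (Q ^ 2) := carlemanWeight_pos (by positivity)
  have hU0 : 0 ≤ ∫ x in Metric.ball (0 : EuclideanSpace ℝ (Fin d)) (6 * Q), u x ^ 2 :=
    integral_nonneg fun x => sq_nonneg _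
  have hI0 : 0 ≤ ∫ x in Θ, u x ^ 2 := integral_nonneg fun x => sq_nonneg _
  have hV0 : 0 ≤ ∫ x in Metric.ball (0 : EuclideanSpace ℝ (Fin d)) (4 * r), u x ^ 2 :=
    integral_nonneg fun x => sq_nonneg _
  have hZ0 : 0 ≤ ∫ x in Metric.ball (0 : EuclideanSpace ℝ (Fin d)) (6 * Q), Z x ^ 2 :=
    integral_nonneg fun x => sq_nonneg _
  generalize (∫ x in Θ, u x ^ 2) = I at *
  generalize (∫ x in Metric.ball (0 : EuclideanSpace ℝ (Fin d)) (6 * Q), u x ^ 2) = U at *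
  generalize (∫ x in Metric.ball (0 : EuclideanSpace ℝ (Fin d)) (4 * r), u x ^ 2) = W at *
  generalize (∫ x in Metric.ball (0 : EuclideanSpace ℝ (Fin d)) (6 * Q), Z x ^ 2) = Y at *
  have h2 : C * (1 + K) * (2 * (A (Q ^ 2) * I)) ≤
      C * (1 + K) * (A (r ^ 2) * (W / r ^ 2 + r ^ 2 * Y) + A (Q ^ 2) * I) := by
    calc C * (1 + K) * (2 * (A (Q ^ 2) * I))
        = 36 * C * Q ^ 2 * (1 + K) / (18 * Q ^ 2) * (A (Q ^ 2) * I) := by field_simp; ring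
      _ ≤ n ^ 3 / (18 * Q ^ 2) * (A (Q ^ 2) * I) := by gcongr
      _ ≤ _ := h1
      _ ≤ C * (A (r ^ 2) * ((1 + K) / r ^ 2 * W + (1 + K) * (r ^ 2 * Y))
            + Real.exp (-(n / 2)) * A (Q ^ 2) * ((1 + K) * U)) := by
          have : r ^ 2 * Y ≤ (1 + K) * (r ^ 2 * Y) :=
            le_mul_of_one_le_left (by positivity) (by linarith)
          gcongr
      _ = C * (1 + K) * (A (r ^ 2) * (W / r ^ 2 + r ^ 2 * Y)
            + A (Q ^ 2) * (Real.exp (-(n / 2)) * U)) := by ring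
      _ ≤ _ := by gcongr
  have h3 : A (Q ^ 2) * I ≤ A (r ^ 2) * (W / r ^ 2 + r ^ 2 * Y) := by
    have := le_of_mul_le_mul_left h2 (by positivity)
    linarith
  have h4 : (r / Q) ^ (2 * q) * I ≤ W / r ^ 2 + r ^ 2 * Y := by
    refine le_of_mul_le_mul_left ?_ hAr0
    calc A (r ^ 2) * ((r / Q) ^ (2 * q) * I) = (r / Q) ^ (2 * q) * A (r ^ 2) * I := by ring
      _ ≤ A (Q ^ 2) * I := by gcongr
      _ ≤ _ := h3
  have h5 : (r / Q) ^ (2 * n + d) = (r / Q) ^ 2 * (r / Q) ^ (2 * q) := by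
    rw [← Real.rpow_natCast (r / Q) 2, ← Real.rpow_add (by positivity), hq]
    congr 1
    push_cast
    ring
  have h6 : (r / Q) ^ 2 ≤ r ^ 2 := by
    gcongr
    exact div_le_self hr.le hQ
  have hr2 : r ^ 2 ≤ 1 := pow_le_one₀ hr.le (by linarith)
  have hX : 0 ≤ (r / Q) ^ (2 * q) * I := mul_nonneg (by positivity) hI0
  calc (r / Q) ^ (2 * n + d) * I = (r / Q) ^ 2 * ((r / Q) ^ (2 * q) * I) := by rw [h5, mul_assoc]
    _ ≤ r ^ 2 * (W / r ^ 2 + r ^ 2 * Y) := by gcongr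
    _ = W + r ^ 2 * (r ^ 2 * Y) := by field_simp
    _ ≤ W + r ^ 2 * (1 * Y) := by gcongr
    _ = _ := by ring

end UniqueContinuation

section Localization

variable {d : ℕ}

lemma exists_contDiff_eq_comp_add {ψ : EuclideanSpace ℝ (Fin d) → ℝ}
    {Ω : Set (EuclideanSpace ℝ (Fin d))} (hΩ : IsOpen Ω) (hψ : ContDiffOn ℝ 2 ψ Ω)
    {x₀ : EuclideanSpace ℝ (Fin d)} {ρ : ℝ} (hρ : 0 < ρ) (hsub : Metric.ball x₀ (ρ + 2) ⊆ Ω) :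
    ∃ u : EuclideanSpace ℝ (Fin d) → ℝ, ContDiff ℝ 2 u ∧
      ∀ y ∈ Metric.ball 0 ρ, u y = ψ (x₀ + y) := by
  let χ : ContDiffBump (0 : EuclideanSpace ℝ (Fin d)) := ⟨ρ, ρ + 1, hρ, by linarith⟩
  refine ⟨fun y => χ y * ψ (x₀ + y), contDiff_iff_contDiffAt.2 fun y => ?_, fun y hy => ?_⟩
  · by_cases hy : y ∈ tsupport χ
    · rw [χ.tsupport_eq, mem_closedBall_zero_iff] at hy
      have hyΩ : x₀ + y ∈ Ω := hsub <| by
        rw [mem_ball_iff_norm, add_sub_cancel_left]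
        exact hy.trans_lt (by change ρ + 1 < ρ + 2; linarith)
      exact χ.contDiffAt.mul <| (hψ.contDiffAt (hΩ.mem_nhds hyΩ)).comp y
        (contDiffAt_const.add contDiffAt_id)
    · refine contDiffAt_const (c := (0 : ℝ)) |>.congr_of_eventuallyEq ?_
      filter_upwards [notMem_tsupport_iff_eventuallyEq.mp hy] with z hz
      simp [hz]
  · simp [χ.one_of_mem_closedBall (Metric.ball_subset_closedBall hy)]

lemma setIntegral_preimage_add_left (x₀ : EuclideanSpace ℝ (Fin d))
    (F : EuclideanSpace ℝ (Fin d) → ℝ) (S : Set (EuclideanSpace ℝ (Fin d))) :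
    ∫ y in (fun y => x₀ + y) ⁻¹' S, F (x₀ + y) = ∫ x in S, F x :=
  (measurePreserving_add_left volume x₀).setIntegral_preimage_emb
    (measurableEmbedding_addLeft x₀) F S

lemma rpow_le_rpow_div_four {t a b : ℝ} (ht : 0 < t) (ht4 : t ≤ 1 / 4) (ha : 0 ≤ a)
    (hab : 2 * a ≤ b) : t ^ b ≤ (t / 4) ^ a :=
  calc t ^ b ≤ t ^ (2 * a) := Real.rpow_le_rpow_of_exponent_ge ht (by linarith) hab
    _ = (t ^ 2) ^ a := by rw [Real.rpow_mul ht.le]; norm_num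
    _ ≤ (t / 4) ^ a := by
      refine Real.rpow_le_rpow (by positivity) ?_ ha
      nlinarith

end Localization

/-- Quantitative unique continuation principle: there is `m > 0`,
depending on `d` only, such that for every open `Ω ⊆ ℝ^d`, `V` with `‖V‖_∞ ≤ K` on `Ω`,
`ψ` twice continuously differentiable and square-integrable on `Ω` with
`ζ := -Δψ + Vψ` square-integrable, every bounded measurable `Θ ⊆ Ω` with `‖ψ_Θ‖₂ > 0`,
every `x₀ ∈ Ω ∖ closure Θ` with `Q := sup_{y∈Θ}|y-x₀| ≥ 1` and `B(x₀, 6Q+2) ⊆ Ω`, and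
every `0 < δ ≤ min{dist(x₀,Θ), 1/24}`:
`(δ/Q)^{m(1+K^{2/3})(Q^{4/3} + log(‖ψ_Ω‖₂/‖ψ_Θ‖₂))} ‖ψ_Θ‖₂² ≤ ‖ψ_{B(x₀,δ)}‖₂² + δ²‖ζ_Ω‖₂²`. -/
theorem quantitative_unique_continuation (d : ℕ) (hd : 1 ≤ d) :
    ∃ m > (0 : ℝ),
      ∀ Ω : Set (EuclideanSpace ℝ (Fin d)), IsOpen Ω →
      ∀ (V : EuclideanSpace ℝ (Fin d) → ℝ) (K : ℝ), Measurable V →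
        (∀ x ∈ Ω, |V x| ≤ K) →
      ∀ ψ : EuclideanSpace ℝ (Fin d) → ℝ, ContDiffOn ℝ 2 ψ Ω →
        IntegrableOn (fun x => ψ x ^ 2) Ω →
        IntegrableOn (fun x => (-(lap ψ x) + V x * ψ x) ^ 2) Ω →
      ∀ Θ : Set (EuclideanSpace ℝ (Fin d)), Θ ⊆ Ω → Bornology.IsBounded Θ →
        MeasurableSet Θ → 0 < ∫ x in Θ, ψ x ^ 2 →
      ∀ x₀ ∈ Ω \ closure Θ, ∀ Q : ℝ, Q = sSup ((fun y => ‖y - x₀‖) '' Θ) → 1 ≤ Q →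
        Metric.ball x₀ (6 * Q + 2) ⊆ Ω →
      ∀ δ : ℝ, 0 < δ → δ ≤ min (Metric.infDist x₀ Θ) (1 / 24) →
        (δ / Q) ^ (m * (1 + K ^ ((2 : ℝ) / 3)) * (Q ^ ((4 : ℝ) / 3) +
            Real.log (Real.sqrt (∫ x in Ω, ψ x ^ 2) / Real.sqrt (∫ x in Θ, ψ x ^ 2)))) *
            ∫ x in Θ, ψ x ^ 2 ≤
          (∫ x in Metric.ball x₀ δ ∩ Ω, ψ x ^ 2) +
            δ ^ 2 * ∫ x in Ω, (-(lap ψ x) + V x * ψ x) ^ 2 := by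
  obtain ⟨M, hM, huc⟩ := unique_continuation_at_zero hd
  refine ⟨4 * (M + 4) + 2 * d, by positivity, ?_⟩
  intro Ω hΩ V K _ hVK ψ hψ hψI hζI Θ hΘΩ hΘb hΘm hΘ0 x₀ hx₀ Q hQ hQ1 hball δ hδ hδle
  have hK : 0 ≤ K := (abs_nonneg _).trans (hVK x₀ hx₀.1)
  obtain ⟨hδΘ, hδ24⟩ := le_min_iff.1 hδle
  have hΘQ : ∀ y ∈ Θ, ‖y - x₀‖ ≤ Q := by
    obtain ⟨B, hB⟩ := hΘb.exists_norm_le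
    intro y hy
    rw [hQ]
    refine le_csSup ⟨B + ‖x₀‖, ?_⟩ (Set.mem_image_of_mem _ hy)
    rintro _ ⟨z, hz, rfl⟩
    exact (norm_sub_le z x₀).trans (by gcongr; exact hB z hz)
  obtain ⟨u, hu, huψ⟩ := exists_contDiff_eq_comp_add hΩ hψ (by positivity : 0 < 6 * Q) hball
  set τ : EuclideanSpace ℝ (Fin d) → EuclideanSpace ℝ (Fin d) := fun y => x₀ + y with hτ
  have hτball : ∀ ρ, τ ⁻¹' Metric.ball x₀ ρ = Metric.ball 0 ρ := fun ρ => by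
    ext y; simp [hτ]
  have hsubΩ : ∀ ρ, ρ ≤ 6 * Q → Metric.ball x₀ ρ ⊆ Ω := fun ρ hρ =>
    (Metric.ball_subset_ball (by linarith)).trans hball
  have hu_int : ∀ S : Set (EuclideanSpace ℝ (Fin d)), MeasurableSet S →
      S ⊆ Metric.ball x₀ (6 * Q) → ∫ y in τ ⁻¹' S, u y ^ 2 = ∫ x in S, ψ x ^ 2 := by
    intro S hS hSQ
    rw [← setIntegral_preimage_add_left x₀ (fun x => ψ x ^ 2) S]
    have hpre : MeasurableSet (τ ⁻¹' S) := measurable_const_add x₀ hS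
    refine setIntegral_congr_fun hpre fun y hy => ?_
    have : y ∈ Metric.ball (0 : EuclideanSpace ℝ (Fin d)) (6 * Q) := hτball (6 * Q) ▸ hSQ hy
    simp only [huψ y this]
  set ζ : EuclideanSpace ℝ (Fin d) → ℝ := fun x => -(lap ψ x) + V x * ψ x with hζ
  have huZ : ∀ y ∈ Metric.ball 0 (6 * Q), |lap u y| ≤ K * |u y| + |ζ (x₀ + y)| := by
    intro y hy
    have heq : u =ᶠ[nhds y] fun z => ψ (x₀ + z) := by
      filter_upwards [Metric.isOpen_ball.mem_nhds hy] with z hz using huψ z hz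
    have hyΩ : x₀ + y ∈ Ω := hsubΩ (6 * Q) le_rfl (by rwa [← hτball] at hy)
    rw [lap_congr heq, lap_comp_add, huψ y hy]
    calc |lap ψ (x₀ + y)| = |V (x₀ + y) * ψ (x₀ + y) - ζ (x₀ + y)| := by
          congr 1; simp only [hζ]; ring
      _ ≤ |V (x₀ + y)| * |ψ (x₀ + y)| + |ζ (x₀ + y)| := by
          rw [← abs_mul]; exact abs_sub _ _
      _ ≤ _ := by gcongr; exact hVK _ hyΩ
  have hZI : IntegrableOn (fun y => ζ (x₀ + y) ^ 2) (Metric.ball 0 (6 * Q)) := by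
    rw [← hτball]
    exact ((measurePreserving_add_left volume x₀).integrableOn_comp_preimage
      (measurableEmbedding_addLeft x₀)).2 (hζI.mono_set (hsubΩ _ le_rfl))
  have hΘball : Θ ⊆ Metric.ball x₀ (6 * Q) := fun y hy =>
    mem_ball_iff_norm.2 ((hΘQ y hy).trans_lt (by linarith))
  have hUle : ∫ x in Θ, ψ x ^ 2 ≤ ∫ x in Ω, ψ x ^ 2 :=
    setIntegral_mono_set hψI (Filter.Eventually.of_forall fun x => sq_nonneg _) hΘΩ.eventuallyLE
  set L := Real.log (Real.sqrt (∫ x in Ω, ψ x ^ 2) / Real.sqrt (∫ x in Θ, ψ x ^ 2)) with hL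
  have hΘs : 0 < Real.sqrt (∫ x in Θ, ψ x ^ 2) := Real.sqrt_pos.2 hΘ0
  have hL0 : 0 ≤ L := Real.log_nonneg ((one_le_div hΘs).2 (Real.sqrt_le_sqrt hUle))
  have hLexp : ∫ x in Ω, ψ x ^ 2 = Real.exp (2 * L) * ∫ x in Θ, ψ x ^ 2 := by
    have hΩ0 := hΘ0.trans_le hUle
    have h2 : Real.exp (2 * L) = Real.exp L ^ 2 := by
      rw [← Real.exp_nat_mul]; norm_num
    rw [h2, hL, Real.exp_log (div_pos (Real.sqrt_pos.2 hΩ0) hΘs), div_pow, Real.sq_sqrt hΩ0.le,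
      Real.sq_sqrt hΘ0.le, div_mul_cancel₀ _ hΘ0.ne']
  set k := K ^ ((2 : ℝ) / 3) with hk
  set p := Q ^ ((4 : ℝ) / 3) with hp
  have hk0 : 0 ≤ k := Real.rpow_nonneg hK _
  have hp1 : 1 ≤ p := Real.one_le_rpow hQ1 (by norm_num)
  set n := (M + 4) * (1 + k) * (p + L) with hn
  have hnM : M * (1 + k) * p ≤ n := by
    rw [hn]
    gcongr <;> linarith
  have hnL : 4 * L ≤ n := by
    calc 4 * L = 4 * 1 * L := by ring
      _ ≤ n := by
        rw [hn]
        gcongr <;> linarith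
  have hn0 : 0 ≤ n := by positivity
  have hexp : Real.exp (-(n / 2)) * (∫ x in Metric.ball 0 (6 * Q), u x ^ 2) ≤
      ∫ x in τ ⁻¹' Θ, u x ^ 2 := by
    rw [← hτball, hu_int _ Metric.isOpen_ball.measurableSet le_rfl, hu_int _ hΘm hΘball]
    calc Real.exp (-(n / 2)) * ∫ x in Metric.ball x₀ (6 * Q), ψ x ^ 2
        ≤ Real.exp (-(n / 2)) * ∫ x in Ω, ψ x ^ 2 := by
          gcongr
          · exact Filter.Eventually.of_forall fun x => sq_nonneg _
          · exact hsubΩ _ le_rfl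
      _ = Real.exp (-(n / 2) + 2 * L) * ∫ x in Θ, ψ x ^ 2 := by
          rw [hLexp, Real.exp_add, mul_assoc]
      _ ≤ 1 * ∫ x in Θ, ψ x ^ 2 := by
          gcongr
          exact Real.exp_le_one_iff.2 (by linarith)
      _ = _ := one_mul _
  have hmain := huc u hu (fun y => ζ (x₀ + y)) K hK Q hQ1 huZ hZI (δ / 4) (by positivity)
    (by linarith) n hnM (τ ⁻¹' Θ) ((measurable_const_add x₀) hΘm)
    (fun y hy => mem_closedBall_zero_iff.2 (by simpa [hτ] using hΘQ _ hy))
    (fun y hy => by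
      have h1 := hδΘ.trans (Metric.infDist_le_dist_of_mem hy)
      rw [dist_comm, dist_eq_norm] at h1
      have h2 : τ y - x₀ = y := by simp [hτ]
      rw [h2] at h1
      linarith) hexp
  rw [hu_int _ hΘm hΘball, ← hτball, ← hτball, mul_div_cancel₀ δ (by norm_num : (4 : ℝ) ≠ 0),
    hu_int _ Metric.isOpen_ball.measurableSet (Metric.ball_subset_ball (by linarith)),
    setIntegral_preimage_add_left x₀ (fun x => ζ x ^ 2)] at hmain
  rw [Set.inter_eq_left.2 (hsubΩ δ (by linarith))]
  have hδQ : δ / Q ≤ 1 / 4 := (div_le_self hδ.le hQ1).trans (by linarith)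
  have hpow : (δ / Q) ^ ((4 * (M + 4) + 2 * d) * (1 + k) * (p + L)) ≤
      (δ / 4 / Q) ^ (2 * n + d) := by
    rw [div_right_comm]
    refine rpow_le_rpow_div_four (by positivity) hδQ (by positivity) ?_
    have h1 : 1 ≤ (1 + k) * (p + L) := one_le_mul_of_one_le_of_one_le (by linarith) (by linarith)
    have h2 : (2 * d : ℝ) * 1 ≤ 2 * d * ((1 + k) * (p + L)) := by gcongr
    rw [hn]
    linarith
  calc _ ≤ (δ / 4 / Q) ^ (2 * n + d) * ∫ x in Θ, ψ x ^ 2 := by gcongr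
    _ ≤ _ := hmain
    _ ≤ _ := by
      have hζ0 : 0 ≤ ∫ x in Metric.ball x₀ (6 * Q), ζ x ^ 2 := integral_nonneg fun x => sq_nonneg _
      gcongr
      · linarith
      · exact Filter.Eventually.of_forall fun x => sq_nonneg _
      · exact hsubΩ _ le_rfl
end
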